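/- arXiv:2408.14782 — 12 statements merged into one kernel-verified Lean document; each statement's English description precedes it below -/
import Mathlib

section
/- Let ρ be a density matrix on ℂ^d with orthonormal eigenbasis {|l⟩} and eigenvalues p_l, and let O be a Hermitian d×d complex matrix. Then the quantum Fisher information is convex with respect to the eigenstate decomposition: F_Q[ρ,O] ≤ Σ_l p_l · 4(⟨l|O²|l⟩ − ⟨l|O|l⟩²), i.e., F_Q of the mixture is at most the p-weighted average of the quantum Fisher informations of its eigenstates. -/
open Matrix

/-- Quantum Fisher information of a density matrix given by its eigenvalues `p`
and orthonormal eigenbasis `e`, with respect to the operator `O`. -/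
noncomputable def QFI {ι : Type*} [Fintype ι] (p : ι → ℝ) (e : ι → ι → ℂ)
    (O : Matrix ι ι ℂ) : ℝ :=
  2 * ∑ l, ∑ l', if 0 < p l + p l' then
    (p l - p l') ^ 2 / (p l + p l') * Complex.normSq (star (e l) ⬝ᵥ O.mulVec (e l'))
  else 0

/-- QFI is convex with respect to the eigenstate decomposition:
`F_Q[ρ,O] ≤ Σ_l p_l · 4(⟨l|O²|l⟩ − ⟨l|O|l⟩²)`. -/
theorem stmt1 {d : ℕ} (p : Fin d → ℝ) (e : Fin d → Fin d → ℂ)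
    (O : Matrix (Fin d) (Fin d) ℂ)
    (horth : ∀ l l', star (e l) ⬝ᵥ e l' = if l = l' then 1 else 0)
    (hp : ∀ l, 0 ≤ p l) (hpsum : ∑ l, p l = 1) (hO : O.IsHermitian) :
    QFI p e O
      ≤ ∑ l, p l * (4 * ((star (e l) ⬝ᵥ (O * O).mulVec (e l)).re
            - ((star (e l) ⬝ᵥ O.mulVec (e l)).re) ^ 2)) := by
  classical
  set U : Matrix (Fin d) (Fin d) ℂ := Matrix.of fun i l => e l i with hU
  have hUU : Uᴴ * U = 1 := by
    ext l l'
    have := horth l l'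
    simpa [Matrix.mul_apply, dotProduct, hU, Matrix.one_apply] using this
  have hUU' : U * Uᴴ = 1 := mul_eq_one_comm.mp hUU
  have key : ∀ (B : Matrix (Fin d) (Fin d) ℂ) (l l' : Fin d),
      star (e l) ⬝ᵥ B.mulVec (e l') = (Uᴴ * (B * U)) l l' := by
    intro B l l'
    simp [Matrix.mul_apply, dotProduct, Matrix.mulVec, hU]
  set M := Uᴴ * (O * U) with hM
  have hMH : Mᴴ = M := by
    rw [hM]
    simp only [Matrix.conjTranspose_mul, Matrix.conjTranspose_conjTranspose, hO.eq, Matrix.mul_assoc]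
  have hMM : Uᴴ * ((O * O) * U) = M * M := by
    calc Uᴴ * ((O * O) * U) = Uᴴ * O * (1 : Matrix (Fin d) (Fin d) ℂ) * O * U := by
          simp only [Matrix.mul_assoc, Matrix.one_mul]
      _ = M * M := by rw [← hUU', hM]; simp only [Matrix.mul_assoc]
  have hs : ∀ l l', M l' l = star (M l l') := by
    intro l l'
    have := congrFun (congrFun hMH l') l
    rw [← this]; simp [Matrix.conjTranspose_apply]
  have hN : ∀ l l', Complex.normSq (M l' l) = Complex.normSq (M l l') := by
    intro l l'
    rw [hs l l']; exact Complex.normSq_conj _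
  have hdiag : ∀ l, ((M l l).re) ^ 2 = Complex.normSq (M l l) := by
    intro l
    have h := congrArg Complex.im (hs l l)
    simp at h
    have h0 : (M l l).im = 0 := by linarith
    rw [Complex.normSq_apply, h0]; ring
  have hsq : ∀ l, ((M * M) l l).re = ∑ l', Complex.normSq (M l l') := by
    intro l
    rw [Matrix.mul_apply, Complex.re_sum]
    refine Finset.sum_congr rfl fun l' _ => ?_
    rw [hs l l', Complex.star_def, Complex.mul_conj, Complex.ofReal_re]
  unfold QFI
  simp only [key, hMM, hsq]
  simp only [← hM, hdiag]
  have hR : ∀ l, (∑ l', Complex.normSq (M l l')) - Complex.normSq (M l l)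
      = ∑ l', if l = l' then 0 else Complex.normSq (M l l') := by
    intro l
    have : Complex.normSq (M l l) = ∑ l', if l = l' then Complex.normSq (M l l') else 0 := by
      simp
    rw [this, ← Finset.sum_sub_distrib]
    refine Finset.sum_congr rfl fun l' _ => ?_
    split_ifs <;> simp
  simp only [hR]
  set K : Fin d → Fin d → ℝ := fun l l' => if l = l' then 0 else Complex.normSq (M l l') with hK
  have hswap : ∑ l, ∑ l', p l * K l l' = ∑ l, ∑ l', p l' * K l l' := by
    rw [Finset.sum_comm]
    refine Finset.sum_congr rfl fun l _ => Finset.sum_congr rfl fun l' _ => ?_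
    simp only [hK, hN l l', eq_comm (a := l') (b := l)]
  have hRHS : ∑ l, p l * (4 * ∑ l', K l l') = 2 * ∑ l, ∑ l', (p l + p l') * K l l' := by
    simp only [add_mul, Finset.sum_add_distrib]
    rw [← hswap, ← two_mul, ← mul_assoc, Finset.mul_sum]
    refine Finset.sum_congr rfl fun l _ => ?_
    rw [← Finset.mul_sum]; ring
  change _ ≤ ∑ l, p l * (4 * ∑ l', K l l')
  rw [hRHS]
  refine mul_le_mul_of_nonneg_left ?_ (by norm_num)
  refine Finset.sum_le_sum fun l _ => Finset.sum_le_sum fun l' _ => ?_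
  by_cases hl : l = l'
  · subst hl; simp [hK]
  · simp only [hK, if_neg hl]
    have h1 := hp l
    have h2 := hp l'
    have h3 := Complex.normSq_nonneg (M l l')
    split_ifs with h
    · refine mul_le_mul_of_nonneg_right ?_ h3
      rw [div_le_iff₀ h]
      nlinarith [mul_nonneg h1 h2]
    · positivity
end

section
/- Let O be a Hermitian d×d complex matrix with largest eigenvalue Λ_M and smallest eigenvalue Λ_m. Then for every density matrix ρ on ℂ^d (with respect to any orthonormal eigenbasis of ρ), the quantum Fisher information satisfies F_Q[ρ,O] ≤ (Λ_M − Λ_m)². -/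
open Matrix

section
open scoped ComplexOrder

lemma aux_psd {d : ℕ} (O : Matrix (Fin d) (Fin d) ℂ) (hO : O.IsHermitian)
    (ΛM Λm : ℝ)
    (hΛM : IsGreatest {μ : ℝ | ∃ v : Fin d → ℂ, v ≠ 0 ∧ O.mulVec v = (μ : ℂ) • v} ΛM)
    (hΛm : IsLeast {μ : ℝ | ∃ v : Fin d → ℂ, v ≠ 0 ∧ O.mulVec v = (μ : ℂ) • v} Λm) :
    ((((ΛM - Λm) / 2) ^ 2 : ℝ) • (1 : Matrix (Fin d) (Fin d) ℂ)
      - (O - ((ΛM + Λm) / 2 : ℝ) • 1) * (O - ((ΛM + Λm) / 2 : ℝ) • 1)).PosSemidef := by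
  have hmem : ∀ i, hO.eigenvalues i ∈
      {μ : ℝ | ∃ v : Fin d → ℂ, v ≠ 0 ∧ O.mulVec v = (μ : ℂ) • v} := by
    intro i
    refine ⟨(hO.eigenvectorBasis i).ofLp, ?_, ?_⟩
    · intro h
      have := hO.eigenvectorBasis.orthonormal.ne_zero i
      apply this
      ext j
      simpa using congrFun h j
    · have := hO.mulVec_eigenvectorBasis i
      rw [this]
      ext j
      simp
  have hsp := hO.spectral_theorem
  set c : ℝ := (ΛM + Λm) / 2 with hc
  set r : ℝ := (ΛM - Λm) / 2 with hr
  set V : Matrix (Fin d) (Fin d) ℂ := (hO.eigenvectorUnitary : Matrix (Fin d) (Fin d) ℂ) with hV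
  have hVV : V * Vᴴ = 1 := by
    have := Matrix.mem_unitaryGroup_iff.1 hO.eigenvectorUnitary.2
    simpa [star_eq_conjTranspose] using this
  have hVV' : Vᴴ * V = 1 := mul_eq_one_comm.1 hVV
  set D : Matrix (Fin d) (Fin d) ℂ := diagonal (fun i => (hO.eigenvalues i : ℂ)) with hD
  have hOV : O = V * D * Vᴴ := by
    conv_lhs => rw [hsp]
    rw [Unitary.conjStarAlgAut_apply]
    rfl
  have hA : O - c • (1 : Matrix (Fin d) (Fin d) ℂ) = V * (D - c • 1) * Vᴴ := by
    rw [mul_sub, sub_mul, ← hOV]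
    simp [hVV]
  have key : (r ^ 2 : ℝ) • (1 : Matrix (Fin d) (Fin d) ℂ)
      - (O - c • 1) * (O - c • 1)
      = V * (diagonal (fun i => ((r ^ 2 - (hO.eigenvalues i - c) ^ 2 : ℝ) : ℂ))) * Vᴴ := by
    have h1 : (diagonal (fun i => ((r ^ 2 - (hO.eigenvalues i - c) ^ 2 : ℝ) : ℂ)))
      = (r ^ 2 : ℝ) • (1 : Matrix (Fin d) (Fin d) ℂ) - (D - c • 1) * (D - c • 1) := by
      have h2 : D - c • (1 : Matrix (Fin d) (Fin d) ℂ)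
          = diagonal (fun i => ((hO.eigenvalues i - c : ℝ) : ℂ)) := by
        ext i j
        by_cases h : i = j
        · subst h; simp [hD]
        · simp [hD, h]
      rw [h2, diagonal_mul_diagonal]
      ext i j
      by_cases h : i = j
      · subst h; simp; ring
      · simp [h]
    rw [h1, hA, mul_sub V (_ • _), sub_mul _ _ Vᴴ]
    congr 1
    · simp [hVV]
    · calc V * (D - c • 1) * Vᴴ * (V * (D - c • 1) * Vᴴ)
          = V * (D - c • 1) * (Vᴴ * V) * (D - c • 1) * Vᴴ := by simp only [Matrix.mul_assoc]
        _ = _ := by rw [hVV']; simp only [Matrix.mul_assoc, Matrix.one_mul]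
  rw [key]
  apply PosSemidef.mul_mul_conjTranspose_same
  apply PosSemidef.diagonal
  intro i
  have h1 := hΛM.2 (hmem i)
  have h2 := hΛm.2 (hmem i)
  have : 0 ≤ r ^ 2 - (hO.eigenvalues i - c) ^ 2 := by
    rw [hr, hc]; nlinarith
  exact Complex.zero_le_real.2 this

lemma aux_row {d : ℕ} (A : Matrix (Fin d) (Fin d) ℂ) (hA : A.IsHermitian) (r : ℝ)
    (h : ((r ^ 2 : ℝ) • (1 : Matrix (Fin d) (Fin d) ℂ) - A * A).PosSemidef)
    (e : Fin d → Fin d → ℂ)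
    (horth : ∀ l l', star (e l) ⬝ᵥ e l' = if l = l' then 1 else 0) (l : Fin d) :
    ∑ l', Complex.normSq (star (e l') ⬝ᵥ A.mulVec (e l)) ≤ r ^ 2 := by
  set E : Matrix (Fin d) (Fin d) ℂ := Matrix.of (fun i j => e j i) with hE
  have hEE : Eᴴ * E = 1 := by
    ext i j
    rw [Matrix.one_apply, ← horth i j]
    simp [Matrix.mul_apply, dotProduct, hE]
  have hEE' : E * Eᴴ = 1 := mul_eq_one_comm.1 hEE
  have hM : ∀ i j, (Eᴴ * A * E) i j = star (e i) ⬝ᵥ A.mulVec (e j) := by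
    intro i j
    rw [Matrix.mul_assoc]
    simp [Matrix.mul_apply, dotProduct, mulVec, hE]
  have h1 := (h.conjTranspose_mul_mul_same E).diag_nonneg (i := l)
  have h2 : Eᴴ * ((r ^ 2 : ℝ) • (1 : Matrix (Fin d) (Fin d) ℂ) - A * A) * E
      = (r ^ 2 : ℝ) • 1 - (Eᴴ * A * E)ᴴ * (Eᴴ * A * E) := by
    rw [mul_sub, sub_mul]
    congr 1
    · simp [hEE]
    · rw [conjTranspose_mul, conjTranspose_mul, conjTranspose_conjTranspose, hA.eq]
      calc Eᴴ * (A * A) * E = Eᴴ * A * 1 * A * E := by simp only [Matrix.mul_assoc, Matrix.one_mul]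
        _ = _ := by rw [← hEE']; simp only [Matrix.mul_assoc]
  rw [h2] at h1
  have h3 : ((Eᴴ * A * E)ᴴ * (Eᴴ * A * E)) l l
      = ((∑ l', Complex.normSq (star (e l') ⬝ᵥ A.mulVec (e l)) : ℝ) : ℂ) := by
    rw [Matrix.mul_apply]
    push_cast
    refine Finset.sum_congr rfl fun i _ => ?_
    rw [conjTranspose_apply, hM, Complex.normSq_eq_conj_mul_self]
    rfl
  rw [Matrix.sub_apply, h3] at h1
  have h4 := (Complex.le_def.1 h1).1
  rw [Complex.sub_re, Complex.ofReal_re] at h4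
  have h5 : (((r ^ 2 : ℝ) • (1 : Matrix (Fin d) (Fin d) ℂ)) l l).re = r ^ 2 := by
    rw [Matrix.smul_apply, Matrix.one_apply_eq, Complex.smul_re]; simp
  rw [h5] at h4
  simpa using h4

end

/-- If `O` is Hermitian with largest eigenvalue `ΛM` and smallest
eigenvalue `Λm`, then for every density matrix (with respect to any orthonormal
eigenbasis of it), `F_Q[ρ,O] ≤ (ΛM − Λm)²`. -/
theorem stmt4 {d : ℕ} (O : Matrix (Fin d) (Fin d) ℂ) (hO : O.IsHermitian)
    (ΛM Λm : ℝ)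
    (hΛM : IsGreatest {μ : ℝ | ∃ v : Fin d → ℂ, v ≠ 0 ∧ O.mulVec v = (μ : ℂ) • v} ΛM)
    (hΛm : IsLeast {μ : ℝ | ∃ v : Fin d → ℂ, v ≠ 0 ∧ O.mulVec v = (μ : ℂ) • v} Λm)
    (p : Fin d → ℝ) (e : Fin d → Fin d → ℂ)
    (horth : ∀ l l', star (e l) ⬝ᵥ e l' = if l = l' then 1 else 0)
    (hp : ∀ l, 0 ≤ p l) (hpsum : ∑ l, p l = 1) :
    QFI p e O ≤ (ΛM - Λm) ^ 2 := by
  set c : ℝ := (ΛM + Λm) / 2 with hc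
  set r : ℝ := (ΛM - Λm) / 2 with hr
  have hpsd := aux_psd O hO ΛM Λm hΛM hΛm
  rw [← hc, ← hr] at hpsd
  set A : Matrix (Fin d) (Fin d) ℂ := O - c • 1 with hAdef
  have hA : A.IsHermitian := by
    rw [hAdef]
    refine hO.sub ?_
    unfold Matrix.IsHermitian
    simp
  have hrow := aux_row A hA r hpsd e horth
  have hAe : ∀ l l', star (e l) ⬝ᵥ A.mulVec (e l')
      = star (e l) ⬝ᵥ O.mulVec (e l') - c • (if l = l' then 1 else 0 : ℂ) := by
    intro l l'
    rw [hAdef, sub_mulVec, smul_mulVec, one_mulVec, dotProduct_sub, dotProduct_smul, horth]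
  set N : Fin d → Fin d → ℝ := fun l l' => Complex.normSq (star (e l) ⬝ᵥ A.mulVec (e l')) with hN
  have hN0 : ∀ l l', 0 ≤ N l l' := fun l l' => Complex.normSq_nonneg _
  have hsymm : ∀ l l', N l l' = N l' l := by
    intro l l'
    have : star (e l) ⬝ᵥ A.mulVec (e l') = star (star (e l') ⬝ᵥ A.mulVec (e l)) := by
      rw [star_dotProduct, star_mulVec, hA.eq, dotProduct_mulVec]
    simp only [hN]
    rw [this]
    exact Complex.normSq_conj _
  have hterm : ∀ l l', (if 0 < p l + p l' then
      (p l - p l') ^ 2 / (p l + p l') * Complex.normSq (star (e l) ⬝ᵥ O.mulVec (e l'))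
      else 0) ≤ p l * N l' l + p l' * N l l' := by
    intro l l'
    have h0 : 0 ≤ p l * N l' l + p l' * N l l' :=
      add_nonneg (mul_nonneg (hp _) (hN0 _ _)) (mul_nonneg (hp _) (hN0 _ _))
    split_ifs with h
    · by_cases hl : l = l'
      · subst hl; simpa using h0
      · have h1 := hAe l l'
        rw [if_neg hl, smul_zero, sub_zero] at h1
        rw [← h1, hsymm l' l, ← add_mul]
        refine mul_le_mul_of_nonneg_right ?_ (hN0 l l')
        rw [div_le_iff₀ h]
        nlinarith [mul_nonneg (hp l) (hp l')]
    · exact h0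
  have hS : ∑ l, p l * ∑ l', N l' l ≤ r ^ 2 := by
    calc ∑ l, p l * ∑ l', N l' l ≤ ∑ l, p l * r ^ 2 :=
          Finset.sum_le_sum fun l _ => mul_le_mul_of_nonneg_left (hrow l) (hp l)
      _ = r ^ 2 := by rw [← Finset.sum_mul, hpsum, one_mul]
  have hT : ∑ l, ∑ l', (p l * N l' l + p l' * N l l') = 2 * ∑ l, p l * ∑ l', N l' l := by
    simp only [Finset.sum_add_distrib, Finset.mul_sum]
    rw [Finset.sum_comm (f := fun l l' => p l' * N l l')]
    simp only [← Finset.mul_sum]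
    ring
  have hle := Finset.sum_le_sum fun l (_ : l ∈ Finset.univ) =>
    Finset.sum_le_sum fun l' (_ : l' ∈ Finset.univ) => hterm l l'
  rw [hT] at hle
  unfold QFI
  have : (ΛM - Λm) ^ 2 = 4 * r ^ 2 := by rw [hr]; ring
  rw [this]
  linarith
end

section
/- Let N, k ≥ 1 be integers, and let Δ_1 ≥ Δ_2 ≥ ⋯ ≥ Δ_N ≥ 0 be real numbers in descending order. For every partition {S_1,…,S_M} of {1,…,N} into disjoint nonempty blocks each of cardinality at most k, one has Σ_{l=1}^M (Σ_{i∈S_l} Δ_i)² ≤ F(k;{Δ_i}), where F(k;{Δ_i}) := Σ_{l=0}^{q−1} (Σ_{j=1}^k Δ_{kl+j})² + (Σ_{j=1}^r Δ_{kq+j})², with q = ⌊N/k⌋ and r = N − kq. That is, the consecutive grouping of the largest values maximizes the sum of squared block sums. -/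
/-- The QFI upper-bound function
`F(k;{Δ}) = Σ_{l=0}^{q−1} (Σ_{j=1}^k Δ_{kl+j})² + (Σ_{j=1}^r Δ_{kq+j})²`
with `q = ⌊N/k⌋`, `r = N − kq`, written with 0-based indices (`Δ 0` is `Δ_1`). -/
noncomputable def Fbound (N k : ℕ) (Δ : ℕ → ℝ) : ℝ :=
  (∑ l ∈ Finset.range (N / k), (∑ j ∈ Finset.range k, Δ (k * l + j)) ^ 2)
    + (∑ j ∈ Finset.range (N % k), Δ (k * (N / k) + j)) ^ 2

lemma aux_abel (f d : ℕ → ℝ) (hf : Antitone f)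
    (hd : ∀ m, 0 ≤ ∑ l ∈ Finset.range m, d l) (n : ℕ) :
    f n * ∑ l ∈ Finset.range (n + 1), d l ≤ ∑ l ∈ Finset.range (n + 1), f l * d l := by
  induction n with
  | zero => simp
  | succ n ih =>
    rw [Finset.sum_range_succ _ (n + 1), Finset.sum_range_succ _ (n + 1)]
    have h1 := hf (Nat.le_succ n)
    have h2 := mul_le_mul_of_nonneg_right h1 (hd (n + 1))
    simp only [Nat.succ_eq_add_one] at h2
    linarith [mul_add (f (n + 1)) (∑ l ∈ Finset.range (n + 1), d l) (d (n + 1))]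

lemma aux_top (g : ℕ → ℝ) (hg : Antitone g) (h0 : ∀ i, 0 ≤ g i) (n : ℕ) :
    ∀ T : Finset ℕ, T.card ≤ n → ∑ i ∈ T, g i ≤ ∑ i ∈ Finset.range n, g i := by
  induction n with
  | zero =>
    intro T hT
    have : T = ∅ := by simpa using hT
    simp [this]
  | succ n ih =>
    intro T hT
    rw [Finset.sum_range_succ]
    by_cases hc : T.card ≤ n
    · linarith [ih T hc, h0 n]
    · have hne : T.Nonempty := by
        rw [← Finset.card_pos]; omega
      have hm := T.max'_mem hne
      set m := T.max' hne with hmdef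
      have hsub : T ⊆ Finset.range (m + 1) := by
        intro x hx
        have := T.le_max' x hx
        simp only [Finset.mem_range]; omega
      have hcard := Finset.card_le_card hsub
      rw [Finset.card_range] at hcard
      have h1 : g m ≤ g n := hg (by omega)
      have h2 := ih (T.erase m) (by rw [Finset.card_erase_of_mem hm]; omega)
      have h3 := Finset.sum_erase_add T g hm
      linarith

lemma aux_block (g : ℕ → ℝ) (k m : ℕ) :
    ∑ l ∈ Finset.range m, ∑ j ∈ Finset.range k, g (k * l + j)
      = ∑ i ∈ Finset.range (k * m), g i := by
  induction m with
  | zero => simp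
  | succ m ih => rw [Finset.sum_range_succ, ih, Nat.mul_succ, Finset.sum_range_add]

theorem stmt6 (N k : ℕ) (hN : 1 ≤ N) (hk : 1 ≤ k) (Δ : ℕ → ℝ)
    (hnonneg : ∀ i, i < N → 0 ≤ Δ i)
    (hdesc : ∀ i j, i ≤ j → j < N → Δ j ≤ Δ i)
    (M : ℕ) (S : Fin M → Finset ℕ)
    (hne : ∀ l, (S l).Nonempty)
    (hdisj : ∀ l l', l ≠ l' → Disjoint (S l) (S l'))
    (hcover : Finset.univ.biUnion S = Finset.range N)
    (hcard : ∀ l, (S l).card ≤ k) :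
    ∑ l, (∑ i ∈ S l, Δ i) ^ 2 ≤ Fbound N k Δ := by
  classical
  set g : ℕ → ℝ := fun i => if i < N then Δ i else 0 with hgdef
  have g0 : ∀ i, 0 ≤ g i := by
    intro i
    simp only [hgdef]; split_ifs with h
    · exact hnonneg i h
    · exact le_rfl
  have ganti : Antitone g := by
    intro i j hij
    by_cases hj : j < N
    · have hi : i < N := by omega
      simp only [hgdef, hi, hj, if_true]; exact hdesc i j hij hj
    · have : g j = 0 := by simp [hgdef, hj]
      rw [this]; exact g0 i
  have hsub : ∀ l, ∀ i ∈ S l, i < N := by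
    intro l i hi
    rw [← Finset.mem_range, ← hcover]
    exact Finset.mem_biUnion.2 ⟨l, Finset.mem_univ _, hi⟩
  have hSg : ∀ l, ∑ i ∈ S l, Δ i = ∑ i ∈ S l, g i := by
    intro l
    refine Finset.sum_congr rfl fun i hi => ?_
    simp [hgdef, hsub l i hi]
  have hNM : N ≤ M * k := by
    have h := Finset.card_biUnion_le_card_mul Finset.univ S k (fun l _ => hcard l)
    rw [hcover] at h; simpa using h
  set s : Fin M → ℝ := fun l => ∑ i ∈ S l, g i with hs
  set σ := Tuple.sort (fun l => - s l) with hσ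
  have hmono : Monotone ((fun l => - s l) ∘ σ) := Tuple.monotone_sort _
  set T : ℕ → Finset ℕ := fun l => if h : l < M then S (σ ⟨l, h⟩) else ∅ with hT
  set f : ℕ → ℝ := fun l => ∑ i ∈ T l, g i with hf
  set c : ℕ → ℝ := fun l => ∑ j ∈ Finset.range k, g (k * l + j) with hc
  have f0 : ∀ l, 0 ≤ f l := fun l => Finset.sum_nonneg fun i _ => g0 i
  have fanti : Antitone f := by
    intro a b hab
    by_cases hb : b < M
    · have ha : a < M := by omega
      have := hmono (show (⟨a, ha⟩ : Fin M) ≤ ⟨b, hb⟩ from hab)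
      simp only [Function.comp, neg_le_neg_iff] at this
      simpa [hf, hT, ha, hb, hs] using this
    · have : f b = 0 := by simp [hf, hT, hb]
      rw [this]; exact f0 a
  have Tcard : ∀ l, (T l).card ≤ k := by
    intro l
    simp only [hT]; split_ifs with h
    · exact hcard _
    · simp
  have Tdisj : ∀ a b, a ≠ b → Disjoint (T a) (T b) := by
    intro a b hab
    simp only [hT]; split_ifs with h h'
    · apply hdisj
      intro he
      have := σ.injective he
      simp at this; exact hab this
    all_goals simp
  have hpart : ∀ m, ∑ l ∈ Finset.range m, f l ≤ ∑ l ∈ Finset.range m, c l := by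
    intro m
    rw [aux_block g k m]
    simp only [hf]
    rw [← Finset.sum_biUnion (fun a _ b _ hab => Tdisj a b hab)]
    apply aux_top g ganti g0
    have := Finset.card_biUnion_le_card_mul (Finset.range m) T k (fun l _ => Tcard l)
    rw [Finset.card_range] at this
    linarith [Nat.mul_comm m k]
  have habel := aux_abel f (fun l => c l - f l) fanti
    (fun m => by rw [Finset.sum_sub_distrib]; linarith [hpart m]) M
  have hL : ∑ l, (∑ i ∈ S l, Δ i) ^ 2 = ∑ l ∈ Finset.range (M + 1), f l ^ 2 := by
    have hM : f M = 0 := by simp [hf, hT]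
    rw [Finset.sum_range_succ, hM, Finset.sum_range, ← Equiv.sum_comp σ]
    simp [hf, hT, hSg]
  have hR : Fbound N k Δ = ∑ l ∈ Finset.range (M + 1), c l ^ 2 := by
    have hdm := Nat.div_add_mod N k
    have hml := Nat.mod_lt N hk
    have hq : N / k ≤ M := by
      apply Nat.div_le_of_le_mul; linarith [Nat.mul_comm M k]
    have hsubset : Finset.range (N / k + 1) ⊆ Finset.range (M + 1) := by
      intro x; simp only [Finset.mem_range]; omega
    rw [← Finset.sum_subset hsubset, Finset.sum_range_succ, Fbound]
    · congr 1
      · refine Finset.sum_congr rfl fun l hl => ?_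
        congr 1
        refine Finset.sum_congr rfl fun j hj => ?_
        rw [Finset.mem_range] at hl hj
        have : k * (l + 1) ≤ k * (N / k) := Nat.mul_le_mul_left k hl
        have : k * l + j < N := by rw [Nat.mul_succ] at this; omega
        simp [hgdef, this]
      · congr 1
        simp only [hc]
        have hs2 : Finset.range (N % k) ⊆ Finset.range k := by
          intro x; simp only [Finset.mem_range]; omega
        rw [← Finset.sum_subset hs2]
        · refine Finset.sum_congr rfl fun j hj => ?_
          rw [Finset.mem_range] at hj
          have : k * (N / k) + j < N := by omega
          simp [hgdef, this]
        · intro j _ hj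
          rw [Finset.mem_range] at hj
          have : ¬ k * (N / k) + j < N := by omega
          simp [hgdef, this]
    · intro l _ hl
      rw [Finset.mem_range] at hl
      have h1 : k * (N / k + 1) ≤ k * l := Nat.mul_le_mul_left k (by omega)
      have : c l = 0 := by
        refine Finset.sum_eq_zero fun j _ => ?_
        have : ¬ k * l + j < N := by rw [Nat.mul_succ] at h1; omega
        simp [hgdef, this]
      simp [this]
  rw [hL, hR]
  have hM0 : f M = 0 := by simp [hf, hT]
  rw [hM0, zero_mul] at habel
  have hkey : ∑ l ∈ Finset.range (M + 1), (f l ^ 2 + 2 * (f l * (c l - f l)))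
      ≤ ∑ l ∈ Finset.range (M + 1), c l ^ 2 :=
    Finset.sum_le_sum fun l _ => by nlinarith [sq_nonneg (c l - f l)]
  rw [Finset.sum_add_distrib, ← Finset.mul_sum] at hkey
  linarith
end

section
/- Let N ≥ 1 and let Δ_1 ≥ Δ_2 ≥ ⋯ ≥ Δ_N ≥ 0 be real numbers in descending order. Then the function k ↦ F(k;{Δ_i}) is monotonically nondecreasing: for all integers 1 ≤ k ≤ N−1, F(k;{Δ_i}) ≤ F(k+1;{Δ_i}). -/
lemma abel_aux (a c : ℕ → ℝ) (ha : Antitone a) 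
    (hP : ∀ m, 0 ≤ ∑ l ∈ Finset.range m, c l) (m : ℕ) :
    a m * ∑ l ∈ Finset.range m, c l ≤ ∑ l ∈ Finset.range m, a l * c l := by
  induction m with
  | zero => simp
  | succ m ih =>
    have h1 : a (m+1) * ∑ l ∈ Finset.range (m+1), c l ≤ a m * ∑ l ∈ Finset.range (m+1), c l :=
      mul_le_mul_of_nonneg_right (ha (Nat.le_succ m)) (hP _)
    refine h1.trans ?_
    rw [Finset.sum_range_succ, Finset.sum_range_succ, mul_add]
    linarith

lemma blocks_sum (d : ℕ → ℝ) (k m : ℕ) :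
    ∑ l ∈ Finset.range m, ∑ j ∈ Finset.range k, d (k * l + j)
      = ∑ i ∈ Finset.range (k * m), d i := by
  induction m with
  | zero => simp
  | succ m ih => rw [Finset.sum_range_succ, ih, Nat.mul_succ, Finset.sum_range_add]

lemma Fbound_eq (N k : ℕ) (hk : 1 ≤ k) (Δ : ℕ → ℝ) :
    Fbound N k Δ = ∑ l ∈ Finset.range (N + 1),
      (∑ j ∈ Finset.range k, (if k * l + j < N then Δ (k * l + j) else 0)) ^ 2 := by
  have hdm := Nat.div_add_mod N k
  have hml := Nat.mod_lt N (show k > 0 by omega)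
  have hle : N / k ≤ N := Nat.div_le_self N k
  have hs : Finset.range (N / k + 1) ⊆ Finset.range (N + 1) := by
    intro x hx
    simp only [Finset.mem_range] at *
    omega
  rw [← Finset.sum_subset hs, Finset.sum_range_succ, Fbound]
  · congr 1
    · refine Finset.sum_congr rfl fun l hl => ?_
      congr 1
      refine Finset.sum_congr rfl fun j hj => ?_
      simp only [Finset.mem_range] at hl hj
      have : k * (l + 1) ≤ k * (N / k) := Nat.mul_le_mul_left k hl
      rw [Nat.mul_succ] at this
      rw [if_pos (by omega)]
    · congr 1
      have hs2 : Finset.range (N % k) ⊆ Finset.range k := by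
        intro x hx
        simp only [Finset.mem_range] at *
        omega
      rw [← Finset.sum_subset hs2]
      · refine Finset.sum_congr rfl fun j hj => ?_
        simp only [Finset.mem_range] at hj
        rw [if_pos (by omega)]
      · intro j _ hj
        simp only [Finset.mem_range] at hj
        rw [if_neg (by omega)]
  · intro l _ hl
    simp only [Finset.mem_range] at hl
    have : k * (N / k + 1) ≤ k * l := Nat.mul_le_mul_left k (by omega)
    rw [Nat.mul_succ] at this
    rw [Finset.sum_eq_zero, zero_pow two_ne_zero]
    intro j _
    rw [if_neg (by omega)]

/-- For a descending nonnegative sequence `Δ_1 ≥ ⋯ ≥ Δ_N ≥ 0`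
(0-based indices `0,…,N−1`), the map `k ↦ F(k;{Δ})` is monotonically
nondecreasing: for `1 ≤ k ≤ N−1`, `F(k;{Δ}) ≤ F(k+1;{Δ})`. -/
theorem stmt7 (N : ℕ) (hN : 1 ≤ N) (Δ : ℕ → ℝ)
    (hnonneg : ∀ i, i < N → 0 ≤ Δ i)
    (hdesc : ∀ i j, i ≤ j → j < N → Δ j ≤ Δ i)
    (k : ℕ) (hk : 1 ≤ k) (hkN : k ≤ N - 1) :
    Fbound N k Δ ≤ Fbound N (k + 1) Δ := by
  rw [Fbound_eq N k hk, Fbound_eq N (k+1) (by omega)]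
  obtain ⟨d, hd⟩ : ∃ d : ℕ → ℝ, d = fun i => if i < N then Δ i else 0 := ⟨_, rfl⟩
  have hd0 : ∀ i, 0 ≤ d i := by
    intro i
    rw [hd]
    dsimp only
    split_ifs with h
    · exact hnonneg i h
    · exact le_rfl
  have hda : Antitone d := by
    intro i j hij
    by_cases h : j < N
    · have h2 : i < N := by omega
      simp only [hd, if_pos h, if_pos h2]
      exact hdesc i j hij h
    · have : d j = 0 := by simp only [hd, if_neg h]
      rw [this]
      exact hd0 i
  have hdi : ∀ i, (if i < N then Δ i else 0) = d i := fun i => by rw [hd]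
  simp only [hdi]
  obtain ⟨a, ha⟩ : ∃ a : ℕ → ℝ, a = fun l => ∑ j ∈ Finset.range k, d (k * l + j) := ⟨_, rfl⟩
  obtain ⟨b, hb⟩ : ∃ b : ℕ → ℝ, b = fun l => ∑ j ∈ Finset.range (k+1), d ((k+1) * l + j) :=
    ⟨_, rfl⟩
  have haa : Antitone a := by
    intro x y hxy
    rw [ha]
    refine Finset.sum_le_sum fun j _ => hda ?_
    have := Nat.mul_le_mul_left k hxy
    omega
  have ha0 : ∀ l, 0 ≤ a l := fun l => by
    rw [ha]
    exact Finset.sum_nonneg fun j _ => hd0 _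
  have hP : ∀ m, 0 ≤ ∑ l ∈ Finset.range m, (b l - a l) := by
    intro m
    rw [Finset.sum_sub_distrib, ha, hb, blocks_sum, blocks_sum, sub_nonneg]
    refine Finset.sum_le_sum_of_subset_of_nonneg ?_ fun i _ _ => hd0 i
    intro x hx
    simp only [Finset.mem_range] at *
    rw [Nat.succ_mul]
    omega
  have key := abel_aux a (fun l => b l - a l) haa hP (N+1)
  have key2 := mul_nonneg (ha0 (N+1)) (hP (N+1))
  have key3 : ∑ l ∈ Finset.range (N+1), (a l ^ 2 + 2 * (a l * (b l - a l)))
      ≤ ∑ l ∈ Finset.range (N+1), b l ^ 2 :=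
    Finset.sum_le_sum fun l _ => by nlinarith [sq_nonneg (b l - a l)]
  rw [Finset.sum_add_distrib, ← Finset.mul_sum] at key3
  have fin : ∑ l ∈ Finset.range (N+1), a l ^ 2 ≤ ∑ l ∈ Finset.range (N+1), b l ^ 2 := by
    linarith
  rw [ha, hb] at fin
  exact fin
end

section
/- (Theorem 1, Upper Bound of QFI.) Consider N particles with local Hilbert spaces ℂ^{d_1},…,ℂ^{d_N}, and for each i a Hermitian operator O_i on ℂ^{d_i} with spectral width Δ_i = λ_max(O_i) − λ_min(O_i); relabel so that Δ_1 ≥ Δ_2 ≥ ⋯ ≥ Δ_N. Let O = Σ_i Õ_i act on the total space (functions on Π_i Fin(d_i)), where Õ_i acts as O_i on slot i and trivially elsewhere. Suppose the density matrix ρ on the total space is k-producible: ρ = Σ_ν p_ν |Ψ_ν⟩⟨Ψ_ν| where each unit vector Ψ_ν factorizes, for some partition of {1,…,N} into blocks of cardinality at most k, as a product over the blocks of vectors on those blocks. Then the quantum Fisher information satisfies F_Q[ρ,O] ≤ F(k;{Δ_i}) := Σ_{l=0}^{q−1} (Σ_{j=1}^k Δ_{kl+j})² + (Σ_{j=1}^r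 Δ_{kq+j})², where q = ⌊N/k⌋ and r = N − kq. -/
open Matrix

/-- The operator acting as `A` on the `i`-th tensor factor and as the identity on
all other factors, as a matrix on the product index set `Π j, Fin (d j)`. -/
noncomputable def localOp {N : ℕ} {d : Fin N → ℕ} (i : Fin N)
    (A : Matrix (Fin (d i)) (Fin (d i)) ℂ) :
    Matrix (∀ j, Fin (d j)) (∀ j, Fin (d j)) ℂ :=
  fun x y => A (x i) (y i) * (if ∀ j, j ≠ i → x j = y j then 1 else 0)

/-- A pure state `Ψ` on the product index set is `k`-producible if it factorizes
over some partition of the `N` particles (encoded as the fibers of a coloring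
`c : Fin N → Fin M`) whose blocks all have cardinality at most `k`. -/
def Producible {N : ℕ} (d : Fin N → ℕ) (k : ℕ) (Ψ : (∀ i, Fin (d i)) → ℂ) : Prop :=
  ∃ (M : ℕ) (c : Fin N → Fin M),
    (∀ m, (Finset.univ.filter (fun i => c i = m)).card ≤ k) ∧
    ∃ φ : ∀ m : Fin M, ((∀ i : {i : Fin N // c i = m}, Fin (d i.val)) → ℂ),
      ∀ x, Ψ x = ∏ m, φ m (fun i => x i.val)

lemma comb_abel (S D : ℕ → ℝ) (hS : Antitone S) (hP : ∀ n, 0 ≤ ∑ l ∈ Finset.range n, D l) (n : ℕ) :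
    S n * ∑ l ∈ Finset.range n, D l ≤ ∑ l ∈ Finset.range n, S l * D l := by
  induction n with
  | zero => simp
  | succ n ih =>
    have h1 := mul_le_mul_of_nonneg_right (hS (Nat.le_succ n)) (hP (n+1))
    rw [Finset.sum_range_succ (fun l => S l * D l)]
    calc _ ≤ _ := h1
      _ = S n * ∑ l ∈ Finset.range n, D l + S n * D n := by rw [Finset.sum_range_succ]; ring
      _ ≤ _ := by linarith

lemma comb_set (Δ : ℕ → ℝ) (hΔ : Antitone Δ) (h0 : ∀ n, 0 ≤ Δ n) (I : Finset ℕ) (n : ℕ)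
    (hI : I.card ≤ n) : ∑ i ∈ I, Δ i ≤ ∑ i ∈ Finset.range n, Δ i := by
  have hc : (I \ Finset.range n).card ≤ (Finset.range n \ I).card := by
    have h1 := Finset.card_sdiff_add_card_inter I (Finset.range n)
    have h2 := Finset.card_sdiff_add_card_inter (Finset.range n) I
    rw [Finset.inter_comm, Finset.card_range] at h2
    omega
  have h1 : ∑ i ∈ I \ Finset.range n, Δ i ≤ (I \ Finset.range n).card • Δ n :=
    Finset.sum_le_card_nsmul _ _ _ (fun i hi => by
      simp at hi; exact hΔ hi.2)
  have h2 : (Finset.range n \ I).card • Δ n ≤ ∑ i ∈ Finset.range n \ I, Δ i :=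
    Finset.card_nsmul_le_sum _ _ _ (fun i hi => by
      simp at hi; exact hΔ hi.1.le)
  have h3 : (I \ Finset.range n).card • Δ n ≤ (Finset.range n \ I).card • Δ n := by
    simp only [nsmul_eq_mul]
    exact mul_le_mul_of_nonneg_right (by exact_mod_cast hc) (h0 n)
  rw [← Finset.sum_inter_add_sum_sdiff I (Finset.range n), ← Finset.sum_inter_add_sum_sdiff (Finset.range n) I,
    Finset.inter_comm]
  linarith

lemma comb_main (N k : ℕ) (Δ : ℕ → ℝ) (hΔ : Antitone Δ) (h0 : ∀ n, 0 ≤ Δ n)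
    (c : Fin N → ℕ) (hc : ∀ m, (Finset.univ.filter (fun i => c i = m)).card ≤ k)
    (hS : Antitone (fun m => ∑ i ∈ Finset.univ.filter (fun i => c i = m), Δ i.val)) (n : ℕ) :
    ∑ m ∈ Finset.range n, (∑ i ∈ Finset.univ.filter (fun i => c i = m), Δ i.val) ^ 2
      ≤ ∑ l ∈ Finset.range n, (∑ j ∈ Finset.range k, Δ (k * l + j)) ^ 2 := by
  set S : ℕ → ℝ := fun m => ∑ i ∈ Finset.univ.filter (fun i => c i = m), Δ i.val with hSd
  set T : ℕ → ℝ := fun l => ∑ j ∈ Finset.range k, Δ (k * l + j) with hTd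
  have hT : ∀ n, ∑ l ∈ Finset.range n, T l = ∑ i ∈ Finset.range (k * n), Δ i := by
    intro n
    induction n with
    | zero => simp
    | succ n ih => rw [Finset.sum_range_succ, ih, Nat.mul_succ, Finset.sum_range_add]
  have hSs : ∀ n, ∑ l ∈ Finset.range n, S l ≤ ∑ l ∈ Finset.range n, T l := by
    intro n
    rw [hT]
    have e1 : ∑ l ∈ Finset.range n, S l
        = ∑ i ∈ (Finset.univ.filter (fun i => c i < n)).map Fin.valEmbedding, Δ i := by
      rw [Finset.sum_map, ← Finset.sum_fiberwise_of_maps_to (s := Finset.univ.filter (fun i => c i < n))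
        (t := Finset.range n) (g := c) (by simp)]
      apply Finset.sum_congr rfl
      intro m hm
      simp only [Finset.mem_range] at hm
      simp only [hSd, Finset.filter_filter, Fin.valEmbedding_apply]
      apply Finset.sum_congr _ (fun _ _ => rfl)
      ext i; simp; omega
    rw [e1]
    apply comb_set Δ hΔ h0
    rw [Finset.card_map, Finset.card_eq_sum_card_fiberwise (f := c) (t := Finset.range n)
      (by intro i; simp)]
    calc _ ≤ ∑ m ∈ Finset.range n, k := by
          apply Finset.sum_le_sum
          intro m hm
          refine le_trans (Finset.card_le_card ?_) (hc m)
          intro i; simp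
      _ = k * n := by simp [mul_comm]
  have h1 := comb_abel S (fun l => T l - S l) hS (fun n => by
    rw [Finset.sum_sub_distrib]; linarith [hSs n]) n
  have h2 : 0 ≤ S n * ∑ l ∈ Finset.range n, (T l - S l) := by
    apply mul_nonneg
    · exact Finset.sum_nonneg (fun i _ => h0 _)
    · rw [Finset.sum_sub_distrib]; linarith [hSs n]
  have h3 : ∑ l ∈ Finset.range n, (S l ^ 2 + 2 * (S l * (T l - S l))) ≤ ∑ l ∈ Finset.range n, T l ^ 2 :=
    Finset.sum_le_sum (fun l _ => by nlinarith [sq_nonneg (T l - S l)])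
  rw [Finset.sum_add_distrib, ← Finset.mul_sum] at h3
  linarith

lemma comb_final (N k : ℕ) (hk : 1 ≤ k) (Δ : ℕ → ℝ) (hdesc : ∀ m n : ℕ, m ≤ n → n < N → Δ n ≤ Δ m)
    (h0 : ∀ n, n < N → 0 ≤ Δ n) (M : ℕ)
    (c : Fin N → Fin M) (hc : ∀ m, (Finset.univ.filter (fun i => c i = m)).card ≤ k) :
    ∑ m, (∑ i ∈ Finset.univ.filter (fun i => c i = m), Δ i.val) ^ 2
     ≤ (∑ l ∈ Finset.range (N / k), (∑ j ∈ Finset.range k, Δ (k * l + j)) ^ 2)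
    + (∑ j ∈ Finset.range (N % k), Δ (k * (N / k) + j)) ^ 2 := by
  set Δ' : ℕ → ℝ := fun n => if n < N then Δ n else 0 with hD
  have hanti : Antitone Δ' := by
    intro m n hmn
    simp only [hD]
    split_ifs with h1 h2 h2
    · exact hdesc m n hmn h1
    · omega
    · exact h0 _ h2
    · exact le_rfl
  have h0' : ∀ n, 0 ≤ Δ' n := by
    intro n; simp only [hD]; split_ifs with h
    · exact h0 n h
    · exact le_rfl
  set f : Fin M → ℝ := fun m => ∑ i ∈ Finset.univ.filter (fun i => c i = m), Δ' i.val with hf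
  have hf0 : ∀ m, 0 ≤ f m := fun m => Finset.sum_nonneg (fun i _ => h0' _)
  set σ := Tuple.sort (fun m => - f m) with hσ
  have hmono : Monotone ((fun m => - f m) ∘ σ) := Tuple.monotone_sort _
  set c' : Fin N → ℕ := fun i => (σ.symm (c i)).val with hc'
  have hfil : ∀ m (h : m < M), Finset.univ.filter (fun i => c' i = m)
      = Finset.univ.filter (fun i => c i = σ ⟨m, h⟩) := by
    intro m h
    ext i
    simp only [hc', Finset.mem_filter, Finset.mem_univ, true_and]
    rw [← Equiv.symm_apply_eq, Fin.ext_iff]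
  have hfil' : ∀ m (h : M ≤ m), Finset.univ.filter (fun i => c' i = m) = ∅ := by
    intro m h
    ext i
    simp only [hc', Finset.mem_filter, Finset.mem_univ, true_and]
    have := (σ.symm (c i)).isLt
    simp; omega
  have key := comb_main N k Δ' hanti h0' c' (by
      intro m
      by_cases h : m < M
      · rw [hfil m h]; exact hc _
      · rw [hfil' m (by omega)]; simp)
    (by
      intro m n hmn
      by_cases h : n < M
      · simp only
        rw [hfil n h, hfil m (by omega)]
        have := @hmono ⟨m, by omega⟩ ⟨n, h⟩ hmn
        simp only [Function.comp] at this
        exact neg_le_neg_iff.mp this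
      · simp only
        rw [hfil' n (by omega)]
        exact Finset.sum_nonneg (fun i _ => h0' _)) M
  have e1 : ∑ m, (∑ i ∈ Finset.univ.filter (fun i => c i = m), Δ i.val) ^ 2
      = ∑ m ∈ Finset.range M, (∑ i ∈ Finset.univ.filter (fun i => c' i = m), Δ' i.val) ^ 2 := by
    rw [Finset.sum_range, ← Equiv.sum_comp σ]
    apply Finset.sum_congr rfl
    intro m _
    rw [hfil m.val m.isLt]
    simp [hD]
  have e2 : (∑ l ∈ Finset.range (N / k), (∑ j ∈ Finset.range k, Δ (k * l + j)) ^ 2)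
    + (∑ j ∈ Finset.range (N % k), Δ (k * (N / k) + j)) ^ 2
    = ∑ l ∈ Finset.range (N / k + 1), (∑ j ∈ Finset.range k, Δ' (k * l + j)) ^ 2 := by
    have hNk := Nat.div_add_mod N k
    have hmod := Nat.mod_lt N hk
    rw [Finset.sum_range_succ]
    congr 1
    · apply Finset.sum_congr rfl
      intro l hl
      congr 1
      apply Finset.sum_congr rfl
      intro j hj
      simp only [Finset.mem_range] at hl hj
      have : k * (l + 1) ≤ k * (N / k) := Nat.mul_le_mul_left _ hl
      rw [Nat.mul_succ] at this
      simp only [hD]; rw [if_pos (by omega)]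
    · congr 1
      rw [← Finset.sum_subset (Finset.range_mono hmod.le)]
      · apply Finset.sum_congr rfl
        intro j hj
        simp only [Finset.mem_range] at hj
        simp only [hD]; rw [if_pos (by omega)]
      · intro j _ hj
        simp only [Finset.mem_range] at hj
        simp only [hD]; rw [if_neg (by omega)]
  rw [e1, e2]
  refine key.trans ?_
  rw [← Finset.sum_filter_ne_zero]
  apply Finset.sum_le_sum_of_subset_of_nonneg _ (fun _ _ _ => sq_nonneg _)
  intro l hl
  replace hl := (Finset.mem_filter.mp hl).2
  simp only [Finset.mem_range]
  by_contra hcon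
  apply hl
  have hNk := Nat.div_add_mod N k
  have hmod := Nat.mod_lt N hk
  have : k * (N / k + 1) ≤ k * l := Nat.mul_le_mul_left _ (by omega)
  rw [Nat.mul_succ] at this
  rw [Finset.sum_eq_zero]; · simp
  intro j _
  simp only [hD]; rw [if_neg (by omega)]


lemma qfi_herm {ι : Type*} [Fintype ι] (M : Matrix ι ι ℂ) (hM : M.IsHermitian) (u v : ι → ℂ) :
    star (star u ⬝ᵥ M *ᵥ v) = star v ⬝ᵥ M *ᵥ u := by
  rw [star_dotProduct, star_mulVec, ← dotProduct_mulVec, hM.eq, star_star]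

lemma qfi_sos {ι : Type*} [Fintype ι] [DecidableEq ι] (O A : Matrix ι ι ℂ) (hO : O.IsHermitian)
    (hA : Aᴴ = -A) (c : ℝ) (ψ : ι → ℂ) :
    (star ψ ⬝ᵥ ((2 : ℂ) • (O * A - A * O) + A * A) *ᵥ ψ).re ≤
     4 * (star ((O - (c : ℂ) • 1) *ᵥ ψ) ⬝ᵥ ((O - (c : ℂ) • 1) *ᵥ ψ)).re := by
  set P := O - (c : ℂ) • (1 : Matrix ι ι ℂ) with hP
  have hPh : Pᴴ = P := by
    simp [hP, hO.eq]
  set B := (2 : ℂ) • P - A with hB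
  have h0 : 0 ≤ (star (B *ᵥ ψ) ⬝ᵥ (B *ᵥ ψ)).re := by
    rw [dotProduct, Complex.re_sum]
    refine Finset.sum_nonneg (fun i _ => ?_)
    simp [Complex.mul_re]
    nlinarith [sq_nonneg ((B *ᵥ ψ) i).re, sq_nonneg ((B *ᵥ ψ) i).im]
  have hBB : Bᴴ * B = (4 : ℂ) • (Pᴴ * P) - ((2 : ℂ) • (O * A - A * O) + A * A) := by
    have : Bᴴ = (2 : ℂ) • P + A := by
      simp [hB, hPh, hA]
    rw [this, hPh, hB]
    simp only [mul_sub, add_mul, smul_mul_assoc, mul_smul_comm, smul_smul]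
    have h2 : P * A - A * P = O * A - A * O := by
      simp [hP, sub_mul, mul_sub]
    rw [← h2]
    module
  have e1 : ∀ B : Matrix ι ι ℂ, star (B *ᵥ ψ) ⬝ᵥ (B *ᵥ ψ) = star ψ ⬝ᵥ (Bᴴ * B) *ᵥ ψ := by
    intro B
    rw [star_mulVec, ← dotProduct_mulVec, mulVec_mulVec]
  rw [e1, hBB, sub_mulVec, dotProduct_sub, smul_mulVec, dotProduct_smul] at h0
  rw [e1]
  simp at h0 ⊢
  linarith

lemma qfi_trace {ι κ : Type*} [Fintype ι] [Fintype κ] (M : Matrix ι ι ℂ) (p : κ → ℝ) (e : κ → ι → ℂ) :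
    (trace ((∑ x, (p x : ℂ) • Matrix.vecMulVec (e x) (star (e x))) * M)).re
      = ∑ x, p x * (star (e x) ⬝ᵥ M *ᵥ (e x)).re := by
  rw [Finset.sum_mul, trace_sum, Complex.re_sum]
  apply Finset.sum_congr rfl
  intro x _
  rw [smul_mul_assoc, trace_smul, vecMulVec_mul, trace_vecMulVec, dotProduct_comm,
    ← dotProduct_mulVec]
  simp

lemma qfi_eq {ι : Type*} [Fintype ι] [DecidableEq ι] (p : ι → ℝ) (hp : ∀ x, 0 ≤ p x)
    (e : ι → ι → ℂ) (horth : ∀ x y, star (e x) ⬝ᵥ e y = if x = y then 1 else 0)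
    (O : Matrix ι ι ℂ) (hO : O.IsHermitian) :
    ∃ A : Matrix ι ι ℂ, Aᴴ = -A ∧ QFI p e O =
      ∑ x, p x * (star (e x) ⬝ᵥ ((2 : ℂ) • (O * A - A * O) + A * A) *ᵥ (e x)).re := by
  set U : Matrix ι ι ℂ := Matrix.of (fun i l => e l i) with hU
  have hUU : Uᴴ * U = 1 := by
    ext x y
    rw [Matrix.one_apply, ← horth x y]
    simp [Matrix.mul_apply, hU, dotProduct]
  have hUU' : U * Uᴴ = 1 := mul_eq_one_comm.mp hUU
  have hent : ∀ (M : Matrix ι ι ℂ) x y, star (e x) ⬝ᵥ M *ᵥ (e y) = (Uᴴ * M * U) x y := by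
    intro M x y
    rw [Matrix.mul_assoc, Matrix.mul_apply]
    simp [dotProduct, hU, mulVec, Matrix.mul_apply]
  set O' := Uᴴ * O * U with hO'
  set w : ι → ι → ℝ := fun x y => (p y - p x) / (p x + p y) with hw
  have hwa : ∀ x y, w y x = - w x y := by
    intro x y; simp only [hw]; rw [add_comm (p y)]; ring
  set A' : Matrix ι ι ℂ := Matrix.of (fun x y => 2 * (w x y : ℂ) * O' x y) with hA'
  have hO'h : O'ᴴ = O' := by simp [hO', hO.eq, Matrix.mul_assoc]
  have hO's : ∀ x y, star (O' x y) = O' y x := by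
    intro x y
    rw [← conjTranspose_apply, hO'h]
  have hA'h : A'ᴴ = -A' := by
    ext x y
    simp only [conjTranspose_apply, hA', of_apply, neg_apply, star_mul', hO's, hwa x y]
    simp
  refine ⟨U * A' * Uᴴ, ?_, ?_⟩
  · simp [hA'h, Matrix.mul_assoc]
  · have hM : Uᴴ * ((2 : ℂ) • (O * (U * A' * Uᴴ) - (U * A' * Uᴴ) * O) + (U * A' * Uᴴ) * (U * A' * Uᴴ)) * U
        = (2 : ℂ) • (O' * A' - A' * O') + A' * A' := by
      have h1 : Uᴴ * (O * (U * A' * Uᴴ)) * U = O' * A' := by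
        calc _ = Uᴴ * O * U * A' * (Uᴴ * U) := by simp only [Matrix.mul_assoc]
          _ = _ := by rw [hUU, Matrix.mul_one]
      have h2 : Uᴴ * ((U * A' * Uᴴ) * O) * U = A' * O' := by
        calc _ = (Uᴴ * U) * A' * (Uᴴ * O * U) := by simp only [Matrix.mul_assoc]
          _ = _ := by rw [hUU, Matrix.one_mul]
      have h3 : Uᴴ * ((U * A' * Uᴴ) * (U * A' * Uᴴ)) * U = A' * A' := by
        calc _ = (Uᴴ * U) * A' * (Uᴴ * U) * A' * (Uᴴ * U) := by simp only [Matrix.mul_assoc]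
          _ = _ := by rw [hUU, Matrix.one_mul, Matrix.mul_one, Matrix.mul_one]
      rw [Matrix.mul_add, Matrix.add_mul, mul_smul_comm, smul_mul_assoc, Matrix.mul_sub, Matrix.sub_mul,
        h1, h2, h3]
    have hn : ∀ x y, O' x y * O' y x = (Complex.normSq (O' x y) : ℂ) := by
      intro x y
      rw [← hO's x y, Complex.normSq_eq_conj_mul_self, mul_comm]; rfl
    have hns : ∀ x y, Complex.normSq (O' x y) = Complex.normSq (O' y x) := by
      intro x y
      rw [← hO's x y]; simp
    have hR : ∀ x, p x * (star (e x) ⬝ᵥ ((2 : ℂ) • (O * (U * A' * Uᴴ) - (U * A' * Uᴴ) * O) + (U * A' * Uᴴ) * (U * A' * Uᴴ)) *ᵥ (e x)).re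
        = ∑ y, p x * (Complex.normSq (O' x y) * (-8 * w x y - 4 * w x y ^ 2)) := by
      intro x
      rw [hent, hM, ← Finset.mul_sum]
      congr 1
      rw [Matrix.add_apply, Matrix.smul_apply, Matrix.sub_apply, Matrix.mul_apply, Matrix.mul_apply,
        Matrix.mul_apply, ← Finset.sum_sub_distrib, Finset.smul_sum, ← Finset.sum_add_distrib, Complex.re_sum]
      apply Finset.sum_congr rfl
      intro y _
      have : (2 : ℂ) • (O' x y * A' y x - A' x y * O' y x) + A' x y * A' y x
          = ((Complex.normSq (O' x y) * (-8 * w x y - 4 * w x y ^ 2) : ℝ) : ℂ) := by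
        push_cast
        rw [← hn x y]
        simp only [hA', of_apply, hwa x y, smul_eq_mul]
        push_cast
        ring
      rw [this, Complex.ofReal_re]
    rw [Finset.sum_congr rfl (fun x _ => hR x)]
    set G : ι → ι → ℝ := fun x y => p x * (Complex.normSq (O' x y) * (-8 * w x y - 4 * w x y ^ 2)) with hG
    have hsym : ∑ x, ∑ y, G x y = (∑ x, ∑ y, (G x y + G y x)) / 2 := by
      simp only [Finset.sum_add_distrib]
      rw [Finset.sum_comm (f := fun x y => G y x)]
      ring
    change _ = ∑ x, ∑ y, G x y
    rw [hsym, QFI, Finset.mul_sum, Finset.sum_div]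
    apply Finset.sum_congr rfl
    intro x _
    rw [Finset.mul_sum, Finset.sum_div]
    apply Finset.sum_congr rfl
    intro y _
    rw [hent]
    simp only [hG]
    rw [hns y x, hwa x y]
    change 2 * (if _ then _ * Complex.normSq (O' x y) else 0) = _
    split_ifs with h
    · simp only [hw]
      field_simp
      ring
    · have h1 : p x = 0 := by linarith [hp x, hp y]
      have h2 : p y = 0 := by linarith [hp x, hp y]
      simp [h1, h2]

lemma qfi_le {ι : Type*} [Fintype ι] [DecidableEq ι] (p : ι → ℝ) (hp : ∀ x, 0 ≤ p x)
    (e : ι → ι → ℂ) (horth : ∀ x y, star (e x) ⬝ᵥ e y = if x = y then 1 else 0)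
    (O : Matrix ι ι ℂ) (hO : O.IsHermitian)
    (K : ℕ) (q : Fin K → ℝ) (Ψ : Fin K → ι → ℂ)
    (hq : ∀ ν, 0 ≤ q ν) (hqsum : ∑ ν, q ν = 1)
    (hρ : ∑ x, (p x : ℂ) • Matrix.vecMulVec (e x) (star (e x))
        = ∑ ν, (q ν : ℂ) • Matrix.vecMulVec (Ψ ν) (star (Ψ ν))) (F : ℝ)
    (hF : ∀ ν, ∃ c : ℝ, 4 * (star ((O - (c : ℂ) • 1) *ᵥ Ψ ν) ⬝ᵥ ((O - (c : ℂ) • 1) *ᵥ Ψ ν)).re ≤ F) :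
    QFI p e O ≤ F := by
  obtain ⟨A, hA, h⟩ := qfi_eq p hp e horth O hO
  rw [h, ← qfi_trace, hρ, qfi_trace]
  calc _ ≤ ∑ ν, q ν * F := by
        apply Finset.sum_le_sum
        intro ν _
        obtain ⟨c, hc⟩ := hF ν
        exact mul_le_mul_of_nonneg_left ((qfi_sos O A hO hA c _).trans hc) (hq ν)
    _ = F := by rw [← Finset.sum_mul, hqsum, one_mul]


lemma localOp_apply {N : ℕ} {d : Fin N → ℕ} (i : Fin N)
    (A : Matrix (Fin (d i)) (Fin (d i)) ℂ) (Ψ : (∀ j, Fin (d j)) → ℂ) (x : ∀ j, Fin (d j)) :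
    (localOp i A *ᵥ Ψ) x = ∑ z, A (x i) z * Ψ (Function.update x i z) := by
  symm
  rw [mulVec, dotProduct]
  apply Finset.sum_of_injOn (fun z => Function.update x i z)
  · intro a _ b _ h
    exact Function.update_injective x i h
  · intro a _; simp
  · intro y _ hy
    have : ¬ ∀ j, j ≠ i → x j = y j := by
      intro h
      apply hy
      refine ⟨y i, by simp, ?_⟩
      funext j
      by_cases hj : j = i
      · subst hj; simp
      · simp [Function.update_of_ne hj, h j hj]
    simp [localOp, this]
  · intro z _
    have : ∀ j, j ≠ i → x j = Function.update x i z j := by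
      intro j hj; simp [Function.update_of_ne hj]
    simp only [localOp]
    rw [if_pos this]
    simp

lemma localOp_herm {N : ℕ} {d : Fin N → ℕ} (i : Fin N)
    (A : Matrix (Fin (d i)) (Fin (d i)) ℂ) (hA : A.IsHermitian) :
    (localOp i A).IsHermitian := by
  ext x y
  have h1 : star (A (y i) (x i)) = A (x i) (y i) := hA.apply _ _
  simp only [conjTranspose_apply, localOp, star_mul']
  rw [h1]
  congr 1
  have : (∀ j, j ≠ i → y j = x j) ↔ (∀ j, j ≠ i → x j = y j) := by
    constructor <;> intro h j hj <;> exact (h j hj).symm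
  simp only [this]
  split_ifs <;> simp

lemma localOp_shift {N : ℕ} {d : Fin N → ℕ} (i : Fin N)
    (A : Matrix (Fin (d i)) (Fin (d i)) ℂ) (b : ℂ) :
    localOp i (A - b • 1) = localOp i A - b • 1 := by
  ext x y
  simp only [localOp, Matrix.sub_apply, Matrix.smul_apply, Matrix.one_apply]
  have : (x = y) ↔ (x i = y i ∧ ∀ j, j ≠ i → x j = y j) := by
    constructor
    · rintro rfl; simp
    · rintro ⟨h1, h2⟩
      funext j
      by_cases hj : j = i
      · subst hj; exact h1
      · exact h2 j hj
  by_cases h1 : x i = y i <;> by_cases h2 : ∀ j, j ≠ i → x j = y j <;> simp [this, h1, h2]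
  split_ifs <;> simp

/-- operator bound for a hermitian matrix -/
lemma herm_bound {n : ℕ} (A : Matrix (Fin n) (Fin n) ℂ) (hA : A.IsHermitian) (lo hi : ℝ)
    (hhi : hi ∈ upperBounds {μ : ℝ | ∃ v : Fin n → ℂ, v ≠ 0 ∧ A.mulVec v = (μ : ℂ) • v})
    (hlo : lo ∈ lowerBounds {μ : ℝ | ∃ v : Fin n → ℂ, v ≠ 0 ∧ A.mulVec v = (μ : ℂ) • v})
    (v : Fin n → ℂ) :
    ∑ z, Complex.normSq (((A - (((lo + hi) / 2 : ℝ) : ℂ) • 1) *ᵥ v) z)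
      ≤ ((hi - lo) / 2) ^ 2 * ∑ z, Complex.normSq (v z) := by
  set b : ℝ := (lo + hi) / 2 with hb
  set E := hA.eigenvectorBasis
  have hn : ∀ u : Fin n → ℂ, ∑ z, Complex.normSq (u z) = ∑ j, ‖inner ℂ (E j) (WithLp.toLp 2 u)‖ ^ 2 := by
    intro u
    rw [E.sum_sq_norm_inner_right, EuclideanSpace.norm_sq_eq]
    simp [Complex.normSq_eq_norm_sq]
  rw [hn, hn, Finset.mul_sum]
  apply Finset.sum_le_sum
  intro j _
  set μ := hA.eigenvalues j
  have hev : A *ᵥ (E j).ofLp = (μ : ℂ) • (E j).ofLp := by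
    have := hA.mulVec_eigenvectorBasis j
    simpa using this
  have hne : (E j).ofLp ≠ 0 := by
    intro h
    have h1 := E.orthonormal.ne_zero j
    apply h1
    ext z; simp [h]
  have h1 : μ ≤ hi := hhi ⟨_, hne, hev⟩
  have h2 : lo ≤ μ := hlo ⟨_, hne, hev⟩
  have hin : inner ℂ (E j) (WithLp.toLp 2 ((A - (b : ℂ) • 1) *ᵥ v))
      = ((μ - b : ℝ) : ℂ) * inner ℂ (E j) (WithLp.toLp 2 v) := by
    rw [EuclideanSpace.inner_eq_star_dotProduct, EuclideanSpace.inner_eq_star_dotProduct]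
    simp only
    rw [dotProduct_comm, sub_mulVec, dotProduct_sub, smul_mulVec, one_mulVec, dotProduct_smul,
      dotProduct_mulVec]
    have : star (E j).ofLp ᵥ* A = (μ : ℂ) • star (E j).ofLp := by
      conv_lhs => rw [← hA.eq]
      rw [← star_mulVec, hev]
      ext z; simp
    rw [this, smul_dotProduct, dotProduct_comm v]
    push_cast
    simp only [smul_eq_mul]
    ring
  rw [hin, norm_mul, mul_pow, Complex.norm_real, Real.norm_eq_abs, sq_abs]
  apply mul_le_mul_of_nonneg_right _ (sq_nonneg _)
  apply sq_le_sq'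
  · linarith
  · linarith

lemma sum_update {N : ℕ} {d : Fin N → ℕ} (i : Fin N) (f : (∀ j, Fin (d j)) → ℝ) :
    ∑ x, ∑ z, f (Function.update x i z) = d i * ∑ x, f x := by
  have h : ∑ x : (∀ j, Fin (d j)), ∑ z : Fin (d i), f (Function.update x i z)
      = ∑ x : (∀ j, Fin (d j)), ∑ z : Fin (d i), f x := by
    rw [← Fintype.sum_prod_type', ← Fintype.sum_prod_type']
    apply Finset.sum_nbij' (fun y => (Function.update y.1 i y.2, y.1 i))
      (fun y => (Function.update y.1 i y.2, y.1 i)) <;> simp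
  rw [h]
  simp [Finset.mul_sum]

lemma localOp_bound {N : ℕ} {d : Fin N → ℕ} (i : Fin N)
    (A : Matrix (Fin (d i)) (Fin (d i)) ℂ) (r : ℝ)
    (hA : ∀ v, ∑ z, Complex.normSq ((A *ᵥ v) z) ≤ r * ∑ z, Complex.normSq (v z))
    (hd : 0 < d i) (Ψ : (∀ j, Fin (d j)) → ℂ) :
    ∑ x, Complex.normSq ((localOp i A *ᵥ Ψ) x) ≤ r * ∑ x, Complex.normSq (Ψ x) := by
  have hd' : (0 : ℝ) < d i := by exact_mod_cast hd
  refine le_of_mul_le_mul_left ?_ hd'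
  rw [mul_left_comm, ← sum_update i, ← sum_update i, Finset.mul_sum]
  apply Finset.sum_le_sum
  intro x _
  refine le_trans (le_of_eq ?_) (hA (fun z => Ψ (Function.update x i z)))
  apply Finset.sum_congr rfl
  intro z _
  rw [localOp_apply]
  simp [mulVec, dotProduct]

def mixf {N M : ℕ} {d : Fin N → ℕ} (c : Fin N → Fin M) (m : Fin M) (x y : ∀ j, Fin (d j)) :
    ∀ j, Fin (d j) := fun j => if c j = m then x j else y j

lemma cov_zero {N M : ℕ} {d : Fin N → ℕ} (c : Fin N → Fin M) (Ψ : (∀ j, Fin (d j)) → ℂ)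
    (hΨ : ∀ m x y, Ψ x * Ψ y = Ψ (mixf c m x y) * Ψ (mixf c m y x))
    (hunit : star Ψ ⬝ᵥ Ψ = 1) (i j : Fin N) (hij : c i ≠ c j)
    (A : Matrix (Fin (d i)) (Fin (d i)) ℂ) (B : Matrix (Fin (d j)) (Fin (d j)) ℂ) :
    star (localOp i A *ᵥ Ψ) ⬝ᵥ (localOp j B *ᵥ Ψ)
     = (star (localOp i A *ᵥ Ψ) ⬝ᵥ Ψ) * (star Ψ ⬝ᵥ (localOp j B *ᵥ Ψ)) := by
  set m := c i with hm
  set u := localOp i A *ᵥ Ψ with hu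
  set v := localOp j B *ᵥ Ψ with hv
  have h1 : ∀ x y, u x * Ψ y = u (mixf c m x y) * Ψ (mixf c m y x) := by
    intro x y
    rw [hu, localOp_apply, localOp_apply, Finset.sum_mul, Finset.sum_mul]
    apply Finset.sum_congr rfl
    intro z _
    rw [mul_assoc, hΨ m, ← mul_assoc]
    have e1 : mixf c m (Function.update x i z) y = Function.update (mixf c m x y) i z := by
      funext l
      by_cases hl : l = i
      · subst hl; simp [mixf, hm]
      · simp [mixf, Function.update_of_ne hl]
    have e2 : mixf c m y (Function.update x i z) = mixf c m y x := by
      funext l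
      by_cases hl : l = i
      · subst hl; simp [mixf, hm]
      · simp [mixf, Function.update_of_ne hl]
    have e3 : mixf c m x y i = x i := by simp [mixf, hm]
    rw [e1, e2, e3, mul_assoc]
  have hj : c j ≠ m := fun h => hij h.symm
  have h2 : ∀ x y, v x * Ψ y = v (mixf c m y x) * Ψ (mixf c m x y) := by
    intro x y
    rw [hv, localOp_apply, localOp_apply, Finset.sum_mul, Finset.sum_mul]
    apply Finset.sum_congr rfl
    intro z _
    rw [mul_assoc, hΨ m]
    have e1 : mixf c m y (Function.update x j z) = Function.update (mixf c m y x) j z := by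
      funext l
      by_cases hl : l = j
      · subst hl; simp [mixf, hj]
      · simp [mixf, Function.update_of_ne hl]
    have e2 : mixf c m (Function.update x j z) y = mixf c m x y := by
      funext l
      by_cases hl : l = j
      · subst hl; simp [mixf, hj]
      · simp [mixf, Function.update_of_ne hl]
    have e3 : mixf c m y x j = x j := by simp [mixf, hj]
    rw [e1, e2, e3]
    ring
  calc star u ⬝ᵥ v = (star u ⬝ᵥ v) * (star Ψ ⬝ᵥ Ψ) := by rw [hunit, mul_one]
    _ = ∑ w : (∀ j, Fin (d j)) × (∀ j, Fin (d j)), star (u w.1 * Ψ w.2) * (v w.1 * Ψ w.2) := by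
      simp only [dotProduct]
      rw [Finset.sum_mul_sum, ← Fintype.sum_prod_type']
      apply Finset.sum_congr rfl
      intro w _
      simp only [Pi.star_apply, star_mul']
      ring
    _ = ∑ w : (∀ j, Fin (d j)) × (∀ j, Fin (d j)),
        star (u w.1 * Ψ w.2) * (Ψ w.1 * v w.2) := by
      apply Finset.sum_nbij' (fun w => (mixf c m w.1 w.2, mixf c m w.2 w.1))
        (fun w => (mixf c m w.1 w.2, mixf c m w.2 w.1))
      · simp
      · simp
      · intro w _
        ext l <;> simp [mixf] <;> split_ifs <;> rfl
      · intro w _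
        ext l <;> simp [mixf] <;> split_ifs <;> rfl
      · intro w _
        simp only
        rw [h1, h2]
        ring
    _ = _ := by
      simp only [dotProduct]
      rw [Finset.sum_mul_sum, ← Fintype.sum_prod_type']
      apply Finset.sum_congr rfl
      intro w _
      simp only [Pi.star_apply, star_mul']
      ring

lemma prod_mix {N k : ℕ} {d : Fin N → ℕ} {Ψ : (∀ j, Fin (d j)) → ℂ} (h : Producible d k Ψ) :
    ∃ (M : ℕ) (c : Fin N → Fin M),
    (∀ m, (Finset.univ.filter (fun i => c i = m)).card ≤ k) ∧
    ∀ m x y, Ψ x * Ψ y = Ψ (mixf c m x y) * Ψ (mixf c m y x) := by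
  obtain ⟨M, c, hc, φ, hφ⟩ := h
  refine ⟨M, c, hc, ?_⟩
  intro m x y
  rw [hφ, hφ, hφ, hφ, ← Finset.prod_mul_distrib, ← Finset.prod_mul_distrib]
  apply Finset.prod_congr rfl
  intro l _
  have e : ∀ x y : (∀ j, Fin (d j)), (fun i : {i : Fin N // c i = l} => mixf c m x y i.val)
      = if l = m then (fun i : {i : Fin N // c i = l} => x i.val)
        else (fun i : {i : Fin N // c i = l} => y i.val) := by
    intro x y
    funext i
    simp only [mixf]
    rw [i.2]
    split_ifs <;> rfl
  rw [e, e]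
  split_ifs
  · rfl
  · ring

lemma hilb {E : Type*} [NormedAddCommGroup E] [InnerProductSpace ℂ E] {N M : ℕ}
    (c : Fin N → Fin M) (ψ : E) (hψ : ‖ψ‖ = 1) (v : Fin N → E) (r : Fin N → ℝ)
    (hr : ∀ i, ‖v i‖ ≤ r i)
    (hcov : ∀ i j, c i ≠ c j → inner ℂ (v i) (v j) = inner ℂ (v i) ψ * inner ℂ ψ (v j)) :
    ‖∑ i, v i - (∑ i, inner ℂ ψ (v i)) • ψ‖ ^ 2
      ≤ ∑ m, (∑ i ∈ Finset.univ.filter (fun i => c i = m), r i) ^ 2 := by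
  set w : Fin N → E := fun i => v i - (inner ℂ ψ (v i)) • ψ with hw
  have hψψ : inner ℂ ψ ψ = (1 : ℂ) := by
    rw [inner_self_eq_norm_sq_to_K, hψ]; simp
  have hww : ∀ i j, inner ℂ (w i) (w j) = inner ℂ (v i) (v j) - inner ℂ (v i) ψ * inner ℂ ψ (v j) := by
    intro i j
    simp only [hw, inner_sub_left, inner_sub_right, inner_smul_left, inner_smul_right, hψψ,
      inner_conj_symm]
    ring
  have hwn : ∀ i, ‖w i‖ ≤ r i := by
    intro i
    refine le_trans ?_ (hr i)
    refine (pow_le_pow_iff_left₀ (norm_nonneg _) (norm_nonneg _) two_ne_zero).mp ?_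
    have h1 := congrArg Complex.re (hww i i)
    rw [← inner_conj_symm (v i) ψ, ← Complex.normSq_eq_conj_mul_self] at h1
    have h2 := inner_self_eq_norm_sq (𝕜 := ℂ) (w i)
    have h3 := inner_self_eq_norm_sq (𝕜 := ℂ) (v i)
    simp only [RCLike.re_eq_complex_re] at h2 h3
    rw [Complex.sub_re, h2, h3, Complex.ofReal_re] at h1
    have := Complex.normSq_nonneg (inner ℂ ψ (v i))
    linarith
  set W : Fin M → E := fun m => ∑ i ∈ Finset.univ.filter (fun i => c i = m), w i with hW
  have e1 : ∑ i, v i - (∑ i, inner ℂ ψ (v i)) • ψ = ∑ m, W m := by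
    rw [Finset.sum_smul, ← Finset.sum_sub_distrib]
    simp only [hW]
    rw [Finset.sum_fiberwise]
  have horth : ∀ m n, m ≠ n → inner ℂ (W m) (W n) = (0 : ℂ) := by
    intro m n hmn
    simp only [hW]
    rw [sum_inner]
    apply Finset.sum_eq_zero
    intro i hi
    rw [inner_sum]
    apply Finset.sum_eq_zero
    intro j hj
    simp only [Finset.mem_filter, Finset.mem_univ, true_and] at hi hj
    rw [hww, hcov i j (by rw [hi, hj]; exact hmn), sub_self]
  have e2 : ‖∑ m, W m‖ ^ 2 = ∑ m, ‖W m‖ ^ 2 := by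
    have h2 := inner_self_eq_norm_sq (𝕜 := ℂ) (∑ m, W m)
    rw [← h2, sum_inner, map_sum]
    apply Finset.sum_congr rfl
    intro m _
    rw [inner_sum, Finset.sum_eq_single m (fun n _ hn => horth m n hn.symm) (by simp)]
    exact inner_self_eq_norm_sq (𝕜 := ℂ) (W m)
  rw [e1, e2]
  apply Finset.sum_le_sum
  intro m _
  apply pow_le_pow_left₀ (norm_nonneg _)
  exact (norm_sum_le _ _).trans (Finset.sum_le_sum (fun i _ => hwn i))

/-- Theorem 1, Upper Bound of QFI: if the density matrix
`ρ = Σ_l p_l |e_l⟩⟨e_l| = Σ_ν q_ν |Ψ_ν⟩⟨Ψ_ν|` is `k`-producible, where each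
particle `i` carries a Hermitian local operator with spectral width
`Δ_i = λ_max − λ_min`, listed in descending order, then
`F_Q[ρ, Σ_i Õ_i] ≤ F(k;{Δ_i})`. -/
theorem stmt8 {N : ℕ} (hN : 1 ≤ N) {d : Fin N → ℕ}
    (O : ∀ i, Matrix (Fin (d i)) (Fin (d i)) ℂ) (hO : ∀ i, (O i).IsHermitian)
    (lo hi : Fin N → ℝ)
    (hhi : ∀ i, IsGreatest
      {μ : ℝ | ∃ v : Fin (d i) → ℂ, v ≠ 0 ∧ (O i).mulVec v = (μ : ℂ) • v} (hi i))
    (hlo : ∀ i, IsLeast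
      {μ : ℝ | ∃ v : Fin (d i) → ℂ, v ≠ 0 ∧ (O i).mulVec v = (μ : ℂ) • v} (lo i))
    (Δ : ℕ → ℝ) (hΔ : ∀ i : Fin N, Δ i.val = hi i - lo i)
    (hdesc : ∀ m n : ℕ, m ≤ n → n < N → Δ n ≤ Δ m)
    (k : ℕ) (hk : 1 ≤ k)
    (p : (∀ i, Fin (d i)) → ℝ) (e : (∀ i, Fin (d i)) → (∀ i, Fin (d i)) → ℂ)
    (horth : ∀ x y, star (e x) ⬝ᵥ e y = if x = y then 1 else 0)
    (hp : ∀ x, 0 ≤ p x) (hpsum : ∑ x, p x = 1)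
    (K : ℕ) (q : Fin K → ℝ) (Ψ : Fin K → (∀ i, Fin (d i)) → ℂ)
    (hq : ∀ ν, 0 ≤ q ν) (hqsum : ∑ ν, q ν = 1)
    (hΨunit : ∀ ν, star (Ψ ν) ⬝ᵥ Ψ ν = 1)
    (hprodu : ∀ ν, Producible d k (Ψ ν))
    (hρ : ∑ x, (p x : ℂ) • Matrix.vecMulVec (e x) (star (e x))
        = ∑ ν, (q ν : ℂ) • Matrix.vecMulVec (Ψ ν) (star (Ψ ν))) :
    QFI p e (∑ i, localOp i (O i)) ≤ Fbound N k Δ := by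
  have hhl : ∀ i, lo i ≤ hi i := fun i => (hlo i).2 (hhi i).1
  have hdpos : ∀ i, 0 < d i := by
    intro i
    obtain ⟨v, hv, -⟩ := (hhi i).1
    by_contra h
    apply hv
    funext z
    exact absurd z.isLt (by omega)
  refine qfi_le p hp e horth _ ?_ K q Ψ hq hqsum hρ _ ?_
  · rw [Matrix.IsHermitian, conjTranspose_sum]
    exact Finset.sum_congr rfl (fun i _ => localOp_herm i _ (hO i))
  intro ν
  obtain ⟨M, c, hc, hmix⟩ := prod_mix (hprodu ν)
  have hcomb := comb_final N k hk Δ hdesc (fun n hn => by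
    have := hΔ ⟨n, hn⟩
    simp only at this
    rw [this]; linarith [hhl ⟨n, hn⟩]) M c hc
  set b : Fin N → ℝ := fun i => (lo i + hi i) / 2 with hb
  set A : ∀ i, Matrix (Fin (d i)) (Fin (d i)) ℂ := fun i => O i - (b i : ℂ) • 1 with hA
  have hAh : ∀ i, (A i).IsHermitian := by
    intro i
    simp [hA, Matrix.IsHermitian, (hO i).eq]
  set ψ : EuclideanSpace ℂ (∀ i, Fin (d i)) := WithLp.toLp 2 (Ψ ν) with hψ
  set v : Fin N → EuclideanSpace ℂ (∀ i, Fin (d i)) :=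
    fun i => WithLp.toLp 2 (localOp i (A i) *ᵥ Ψ ν) with hv
  have hin : ∀ u w : (∀ i, Fin (d i)) → ℂ,
      inner ℂ (WithLp.toLp 2 u : EuclideanSpace ℂ (∀ i, Fin (d i))) (WithLp.toLp 2 w)
        = star u ⬝ᵥ w := by
    intro u w
    rw [EuclideanSpace.inner_eq_star_dotProduct, dotProduct_comm]
  have hns : ∀ u : (∀ i, Fin (d i)) → ℂ,
      ‖(WithLp.toLp 2 u : EuclideanSpace ℂ (∀ i, Fin (d i)))‖ ^ 2 = (star u ⬝ᵥ u).re := by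
    intro u
    rw [← hin, ← inner_self_eq_norm_sq (𝕜 := ℂ)]
    rfl
  have hnq : ∀ u : (∀ i, Fin (d i)) → ℂ,
      ‖(WithLp.toLp 2 u : EuclideanSpace ℂ (∀ i, Fin (d i)))‖ ^ 2 = ∑ x, Complex.normSq (u x) := by
    intro u
    rw [EuclideanSpace.norm_sq_eq]
    simp [Complex.normSq_eq_norm_sq]
  have hψ1s : ‖ψ‖ ^ 2 = 1 := by rw [hψ, hns, hΨunit]; simp
  have hψ1 : ‖ψ‖ = 1 := by
    nlinarith [norm_nonneg ψ]
  have hH := hilb c ψ hψ1 v (fun i => Δ i.val / 2) (by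
      intro i
      have h1 := localOp_bound i (A i) (((hi i - lo i) / 2) ^ 2)
        (herm_bound (O i) (hO i) (lo i) (hi i) (hhi i).2 (hlo i).2) (hdpos i) (Ψ ν)
      rw [← hnq, ← hnq, ← hψ, hψ1s, mul_one] at h1
      rw [hΔ i]
      exact (pow_le_pow_iff_left₀ (norm_nonneg _) (by linarith [hhl i]) two_ne_zero).mp h1)
    (by
      intro i j hij
      simp only [hv, hψ, hin]
      exact cov_zero c (Ψ ν) hmix (hΨunit ν) i j hij (A i) (A j))
  refine ⟨∑ i, b i + ∑ i, (inner ℂ ψ (v i)).re, ?_⟩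
  have hreal : ∀ i, (((inner ℂ ψ (v i)).re : ℝ) : ℂ) = inner ℂ ψ (v i) := by
    intro i
    apply Complex.conj_eq_iff_re.mp
    simp only [hv, hψ, hin]
    exact qfi_herm _ (localOp_herm i _ (hAh i)) (Ψ ν) (Ψ ν)
  have heq : (WithLp.toLp 2 ((∑ i, localOp i (O i)
      - ((∑ i, b i + ∑ i, (inner ℂ ψ (v i)).re : ℝ) : ℂ) • 1) *ᵥ Ψ ν) : EuclideanSpace ℂ (∀ i, Fin (d i)))
      = ∑ i, v i - (∑ i, inner ℂ ψ (v i)) • ψ := by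
    have h1 : ∑ i, v i = WithLp.toLp 2 ((∑ i, localOp i (A i)) *ᵥ Ψ ν) := by
      rw [sum_mulVec, WithLp.toLp_sum]
    have h2 : ∑ i, localOp i (A i) = ∑ i, localOp i (O i) - (∑ i, (b i : ℂ)) • 1 := by
      simp only [hA, localOp_shift]
      rw [Finset.sum_sub_distrib, Finset.sum_smul]
    rw [h1, h2, hψ, ← WithLp.toLp_smul, ← WithLp.toLp_sub]
    congr 1
    push_cast
    rw [← Finset.sum_congr rfl (fun i _ => hreal i)]
    rw [sub_mulVec, sub_mulVec, smul_mulVec, smul_mulVec, one_mulVec, add_smul]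
    abel
  rw [← hns, heq]
  refine le_trans ?_ hcomb
  calc _ ≤ _ := mul_le_mul_of_nonneg_left hH (by norm_num)
    _ = _ := by
      rw [Finset.mul_sum]
      apply Finset.sum_congr rfl
      intro m _
      rw [← Finset.sum_div]
      ring
end

section
/- Let |0⟩ and |1⟩ be two orthonormal vectors in ℂ^d, let ξ ∈ [0,1], and let ρ = ((1+ξ)/2)|0⟩⟨0| + ((1−ξ)/2)|1⟩⟨1| be the rank-two density matrix with all other eigenvalues zero. Then for every Hermitian d×d matrix O, the quantum Fisher information satisfies F_Q[ρ,O] = ((1+ξ)/2)·4(⟨0|O²|0⟩ − ⟨0|O|0⟩²) + ((1−ξ)/2)·4(⟨1|O²|1⟩ − ⟨1|O|1⟩²) − 4(1−ξ²)·|⟨1|O|0⟩|². -/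
open Matrix

/-- For the rank-two density matrix
`ρ = ((1+ξ)/2)|0⟩⟨0| + ((1−ξ)/2)|1⟩⟨1|` (all other eigenvalues zero), with
`|0⟩ = e i₀`, `|1⟩ = e i₁` members of an orthonormal eigenbasis `e` and
`ξ ∈ [0,1]`, and any Hermitian `O`,
`F_Q[ρ,O] = ((1+ξ)/2)·4(⟨0|O²|0⟩ − ⟨0|O|0⟩²) + ((1−ξ)/2)·4(⟨1|O²|1⟩ − ⟨1|O|1⟩²)
  − 4(1−ξ²)·|⟨1|O|0⟩|²`. -/
theorem stmt12 {d : ℕ} (ξ : ℝ) (hξ0 : 0 ≤ ξ) (hξ1 : ξ ≤ 1)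
    (e : Fin d → Fin d → ℂ)
    (horth : ∀ l l', star (e l) ⬝ᵥ e l' = if l = l' then 1 else 0)
    (i₀ i₁ : Fin d) (hne : i₀ ≠ i₁)
    (p : Fin d → ℝ)
    (hp : p = fun l => if l = i₀ then (1 + ξ) / 2 else if l = i₁ then (1 - ξ) / 2 else 0)
    (O : Matrix (Fin d) (Fin d) ℂ) (hO : O.IsHermitian) :
    QFI p e O
      = (1 + ξ) / 2 * (4 * ((star (e i₀) ⬝ᵥ (O * O).mulVec (e i₀)).re
            - ((star (e i₀) ⬝ᵥ O.mulVec (e i₀)).re) ^ 2))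
        + (1 - ξ) / 2 * (4 * ((star (e i₁) ⬝ᵥ (O * O).mulVec (e i₁)).re
            - ((star (e i₁) ⬝ᵥ O.mulVec (e i₁)).re) ^ 2))
        - 4 * (1 - ξ ^ 2) * Complex.normSq (star (e i₁) ⬝ᵥ O.mulVec (e i₀)) := by
  classical
  set V : Matrix (Fin d) (Fin d) ℂ := Matrix.of (fun l k => star (e l k)) with hV
  have hent : ∀ (A : Matrix (Fin d) (Fin d) ℂ) l l',
      star (e l) ⬝ᵥ A.mulVec (e l') = (V * A * Vᴴ) l l' := by
    intro A l l'
    rw [Matrix.mul_assoc]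
    simp [hV, Matrix.mul_apply, dotProduct, Matrix.mulVec]
  have hVV : V * Vᴴ = 1 := by
    ext l l'
    have h := horth l l'
    simp only [Matrix.one_apply, ← h]
    simp [hV, Matrix.mul_apply, dotProduct]
  have hVV' : Vᴴ * V = 1 := mul_eq_one_comm.mp hVV
  set M := V * O * Vᴴ with hM
  have hMM : V * (O * O) * Vᴴ = M * M := by
    calc V * (O * O) * Vᴴ = V * O * 1 * O * Vᴴ := by simp only [Matrix.mul_assoc, Matrix.one_mul]
      _ = M * M := by rw [← hVV', hM]; simp only [Matrix.mul_assoc]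
  have hMH : ∀ l l', M l l' = star (M l' l) := by
    have : Mᴴ = M := by
      rw [hM]
      simp [Matrix.conjTranspose_mul, hO.eq, Matrix.mul_assoc]
    intro l l'
    conv_lhs => rw [← this]
    rfl
  have hsym : ∀ l l', Complex.normSq (M l l') = Complex.normSq (M l' l) := by
    intro l l'
    rw [hMH l l']
    exact Complex.normSq_conj _
  have hsq : ∀ l, ((M * M) l l).re = ∑ l', Complex.normSq (M l l') := by
    intro l
    rw [Matrix.mul_apply, Complex.re_sum]
    refine Finset.sum_congr rfl fun k _ => ?_
    rw [hMH k l]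
    simp [Complex.normSq_apply]
  have hdiag : ∀ l, (M l l).re ^ 2 = Complex.normSq (M l l) := by
    intro l
    have h := congrArg Complex.im (hMH l l)
    simp at h
    have h0 : (M l l).im = 0 := by linarith
    rw [Complex.normSq_apply, h0]; ring
  unfold QFI
  simp only [hent, hMM]
  simp only [← hM]
  rw [hdiag, hdiag, hsq, hsq]
  generalize hN : (fun l l' => Complex.normSq (M l l')) = N
  have hN' : ∀ l l', Complex.normSq (M l l') = N l l' := fun l l' => by rw [← hN]
  simp only [hN'] at hsym ⊢
  have hpn : ∀ l, 0 ≤ p l := by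
    intro l; rw [hp]; dsimp only
    split_ifs <;> linarith
  have hp0 : p i₀ = (1 + ξ) / 2 := by simp [hp]
  have hp1 : p i₁ = (1 - ξ) / 2 := by simp [hp, hne.symm]
  have hpz : ∀ l, l ≠ i₀ ∧ l ≠ i₁ → p l = 0 := by
    rintro l ⟨h1, h2⟩; simp [hp, h1, h2]
  clear hp
  have hterm : ∀ l l', (if 0 < p l + p l' then
      (p l - p l') ^ 2 / (p l + p l') * N l l' else 0)
      = p l * N l l' + p l' * N l' l - p l * (4 * (p l' / (p l + p l') * N l l')) := by
    intro l l'
    rw [hsym l' l]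
    split_ifs with h
    · field_simp; ring
    · have h1 : p l = 0 := by linarith [hpn l, hpn l']
      have h2 : p l' = 0 := by linarith [hpn l, hpn l']
      simp [h1, h2]
  simp only [hterm, Finset.sum_sub_distrib, Finset.sum_add_distrib]
  rw [Finset.sum_comm (f := fun l l' => p l' * N l' l)]
  simp only [← Finset.mul_sum]
  have key : ∀ g : Fin d → ℝ, ∑ l, p l * g l = p i₀ * g i₀ + p i₁ * g i₁ := fun g =>
    Fintype.sum_eq_add i₀ i₁ hne (fun l hl => by rw [hpz l hl]; simp)
  rw [key (fun l => ∑ i, N l i), key (fun l => 4 * ∑ i, p i / (p l + p i) * N l i)]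
  rw [
    Fintype.sum_eq_add (f := fun l' => p l' / (p i₀ + p l') * N i₀ l') i₀ i₁ hne
      (fun l hl => by simp only [hpz l hl]; simp),
    Fintype.sum_eq_add (f := fun l' => p l' / (p i₁ + p l') * N i₁ l') i₀ i₁ hne
      (fun l hl => by simp only [hpz l hl]; simp), hp0, hp1, hsym i₀ i₁]
  have e1 : (1 + ξ) / 2 + (1 - ξ) / 2 = 1 := by ring
  have e2 : (1 - ξ) / 2 + (1 + ξ) / 2 = 1 := by ring
  have e3 : (1 + ξ) / 2 / ((1 + ξ) / 2 + (1 + ξ) / 2) = 1 / 2 := by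
    have : 1 + ξ ≠ 0 := by positivity
    field_simp; ring
  have e4 : (1 - ξ) / 2 * (4 * ((1 - ξ) / 2 / ((1 - ξ) / 2 + (1 - ξ) / 2) * N i₁ i₁))
      = (1 - ξ) * N i₁ i₁ := by
    by_cases h : 1 - ξ = 0
    · simp [h]
    · field_simp; ring
  rw [e1, e2, e3]
  linear_combination (-2) * e4
end

section
/- Let ρ be a density matrix on ℂ^d, P a unitary d×d matrix, and A, B Hermitian d×d matrices such that PρP† = ρ, PAP† = A, and PBP† = −B. Suppose ρ admits an orthonormal eigenbasis {|l⟩} (eigenvalues p_l) consisting of eigenvectors of P. Then the quantum Fisher information computed in this basis is additive: F_Q[ρ, A + B] = F_Q[ρ, A] + F_Q[ρ, B]. In particular, the symmetry-respecting and symmetry-breaking perturbations contribute independently, with no cross term. -/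
open Matrix

theorem aux13 {d : ℕ} (u v : Fin d → ℂ) (P O : Matrix (Fin d) (Fin d) ℂ)
    (hP' : P.conjTranspose * P = 1) (c m n : ℂ)
    (hO : P * O * P.conjTranspose = c • O)
    (hu : P.mulVec u = m • u) (hv : P.mulVec v = n • v) :
    star u ⬝ᵥ O.mulVec v = c * (star m * n) * (star u ⬝ᵥ O.mulVec v) := by
  have h1 : P * O = c • (O * P) := by
    calc P * O = P * O * (P.conjTranspose * P) := by rw [hP', mul_one]
      _ = (P * O * P.conjTranspose) * P := by simp only [mul_assoc]
      _ = c • (O * P) := by rw [hO, smul_mul_assoc]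
  have h2 : star (P.mulVec u) ⬝ᵥ P.mulVec (O.mulVec v) = star u ⬝ᵥ O.mulVec v := by
    rw [Matrix.star_mulVec, ← Matrix.dotProduct_mulVec, Matrix.mulVec_mulVec, hP',
      Matrix.one_mulVec]
  rw [Matrix.mulVec_mulVec, h1, Matrix.smul_mulVec, ← Matrix.mulVec_mulVec, hu, hv,
    Matrix.mulVec_smul, star_smul, smul_dotProduct, dotProduct_smul, dotProduct_smul] at h2
  simp only [smul_eq_mul] at h2
  linear_combination -h2

/-- Let `ρ = Σ_l p_l |e_l⟩⟨e_l|` be a density matrix, `P` unitary,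
and `A`, `B` Hermitian with `PρP† = ρ`, `PAP† = A`, `PBP† = −B`. If the
orthonormal eigenbasis `e` of `ρ` consists of eigenvectors of `P`, then the QFI
computed in this basis is additive: `F_Q[ρ, A + B] = F_Q[ρ, A] + F_Q[ρ, B]`. -/
theorem stmt13 {d : ℕ} (p : Fin d → ℝ) (e : Fin d → Fin d → ℂ)
    (horth : ∀ l l', star (e l) ⬝ᵥ e l' = if l = l' then 1 else 0)
    (hp : ∀ l, 0 ≤ p l) (hpsum : ∑ l, p l = 1)
    (P A B : Matrix (Fin d) (Fin d) ℂ)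
    (hP : P * P.conjTranspose = 1) (hP' : P.conjTranspose * P = 1)
    (hA : A.IsHermitian) (hB : B.IsHermitian)
    (hρsym : P * (∑ l, (p l : ℂ) • Matrix.vecMulVec (e l) (star (e l)))
        * P.conjTranspose = ∑ l, (p l : ℂ) • Matrix.vecMulVec (e l) (star (e l)))
    (hAsym : P * A * P.conjTranspose = A)
    (hBanti : P * B * P.conjTranspose = -B)
    (μ : Fin d → ℂ) (heigP : ∀ l, P.mulVec (e l) = μ l • e l) :
    QFI p e (A + B) = QFI p e A + QFI p e B := by
  unfold QFI
  rw [← mul_add, ← Finset.sum_add_distrib]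
  congr 1
  refine Finset.sum_congr rfl fun l _ => ?_
  rw [← Finset.sum_add_distrib]
  refine Finset.sum_congr rfl fun l' _ => ?_
  split_ifs with h
  swap
  · simp
  rw [← mul_add]
  congr 1
  have ha := aux13 (e l) (e l') P A hP' 1 (μ l) (μ l') (by simpa using hAsym) (heigP l) (heigP l')
  have hb := aux13 (e l) (e l') P B hP' (-1) (μ l) (μ l') (by simpa using hBanti)
    (heigP l) (heigP l')
  rw [Matrix.add_mulVec, dotProduct_add]
  generalize star (e l) ⬝ᵥ A.mulVec (e l') = a at *
  generalize star (e l) ⬝ᵥ B.mulVec (e l') = b at *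
  have hab : a * b = 0 := by
    linear_combination (b / 2) * ha + (a / 2) * hb
  rcases mul_eq_zero.mp hab with h0 | h0 <;> simp [h0]
end

section
/- Let ω_c, ω_m > 0, N > 0, κ ≥ 0, G > 0, and define the classical potential E(α,θ) = (ω_c + 4κG²/ω_m)α² − 2G√N·α·sin θ + (ω_m N/2)(1 − cos θ) for α ∈ ℝ and θ ∈ [−π/2, π/2]. If either κ ≥ 1, or κ < 1 and G ≤ G_c := √(ω_m ω_c/(4(1−κ))), then E(α,θ) ≥ 0 = E(0,0) for all (α,θ) ∈ ℝ × [−π/2,π/2]; moreover, if κ ≥ 1 or G < G_c, the global minimum is attained only at (α,θ) = (0,0). -/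
/-- The classical mean-field potential of the squeezed Dicke model:
`E(α,θ) = (ω_c + 4κG²/ω_m)α² − 2G√N·α·sin θ + (ω_m N/2)(1 − cos θ)`. -/
noncomputable def Ecl (ωc ωm N κ G α θ : ℝ) : ℝ :=
  (ωc + 4 * κ * G ^ 2 / ωm) * α ^ 2 - 2 * G * Real.sqrt N * α * Real.sin θ
    + ωm * N / 2 * (1 - Real.cos θ)

theorem Ecl_sos (ωc ωm N κ G α θ : ℝ) (hωm : 0 < ωm) (hN : 0 < N) :
    Ecl ωc ωm N κ G α θ = (ωm * ωc - 4 * (1 - κ) * G ^ 2) / ωm * α ^ 2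
      + ωm / 4 * (4 * G * α / ωm - Real.sqrt N * Real.sin θ) ^ 2
      + ωm * N / 4 * (1 - Real.cos θ) ^ 2 := by
  have h1 : Real.sqrt N ^ 2 = N := Real.sq_sqrt hN.le
  have h2 : Real.sin θ ^ 2 = 1 - Real.cos θ ^ 2 := Real.sin_sq θ
  have h3 : (4 * G * α / ωm - Real.sqrt N * Real.sin θ) ^ 2 =
      (4 * G * α / ωm) ^ 2 - 2 * (4 * G * α / ωm) * (Real.sqrt N * Real.sin θ)
        + N * (1 - Real.cos θ ^ 2) := by
    rw [← h2]; nth_rewrite 3 [← h1]; ring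
  rw [h3]
  unfold Ecl
  field_simp
  ring

/-- If `κ ≥ 1`, or `κ < 1` and `G ≤ G_c = √(ω_m ω_c/(4(1−κ)))`,
then `E(α,θ) ≥ 0 = E(0,0)` on `ℝ × [−π/2, π/2]`; moreover if `κ ≥ 1` or
`G < G_c`, the global minimum `0` is attained only at `(α,θ) = (0,0)`. -/
theorem stmt14 (ωc ωm N κ G : ℝ) (hωc : 0 < ωc) (hωm : 0 < ωm) (hN : 0 < N)
    (hκ : 0 ≤ κ) (hG : 0 < G)
    (hcond : 1 ≤ κ ∨ (κ < 1 ∧ G ≤ Real.sqrt (ωm * ωc / (4 * (1 - κ))))) :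
    (∀ α θ : ℝ, θ ∈ Set.Icc (-(Real.pi / 2)) (Real.pi / 2) →
        0 ≤ Ecl ωc ωm N κ G α θ)
      ∧ Ecl ωc ωm N κ G 0 0 = 0
      ∧ ((1 ≤ κ ∨ G < Real.sqrt (ωm * ωc / (4 * (1 - κ)))) →
          ∀ α θ : ℝ, θ ∈ Set.Icc (-(Real.pi / 2)) (Real.pi / 2) →
            Ecl ωc ωm N κ G α θ = 0 → α = 0 ∧ θ = 0) := by
  have key : 0 ≤ ωm * ωc - 4 * (1 - κ) * G ^ 2 := by
    rcases hcond with h | ⟨h, hg⟩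
    · nlinarith [mul_pos hωm hωc, mul_nonneg (sub_nonneg.2 h) (sq_nonneg G)]
    · have h4 : 0 < 4 * (1 - κ) := by linarith
      have := (Real.le_sqrt' hG).1 hg
      rw [le_div_iff₀ h4] at this
      linarith
  refine ⟨?_, by simp [Ecl], ?_⟩
  · intro α θ _
    rw [Ecl_sos _ _ _ _ _ _ _ hωm hN]
    positivity
  · intro hs α θ hθ h0
    have keys : 0 < ωm * ωc - 4 * (1 - κ) * G ^ 2 := by
      by_cases h : 1 ≤ κ
      · nlinarith [mul_pos hωm hωc, mul_nonneg (sub_nonneg.2 h) (sq_nonneg G)]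
      · have hg := hs.resolve_left h
        have h4 : 0 < 4 * (1 - κ) := by linarith
        have := (Real.lt_sqrt hG.le).1 hg
        rw [lt_div_iff₀ h4] at this
        linarith
    rw [Ecl_sos _ _ _ _ _ _ _ hωm hN] at h0
    have a1 : 0 < (ωm * ωc - 4 * (1 - κ) * G ^ 2) / ωm := div_pos keys hωm
    have a2 : 0 < ωm * N / 4 := by positivity
    have b1 := mul_nonneg a1.le (sq_nonneg α)
    have b2 := mul_nonneg a2.le (sq_nonneg (1 - Real.cos θ))
    have b3 : 0 ≤ ωm / 4 * (4 * G * α / ωm - Real.sqrt N * Real.sin θ) ^ 2 := by positivity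
    have c1 : (ωm * ωc - 4 * (1 - κ) * G ^ 2) / ωm * α ^ 2 = 0 := by linarith
    have c2 : ωm * N / 4 * (1 - Real.cos θ) ^ 2 = 0 := by linarith
    have d1 := (mul_eq_zero.1 c1).resolve_left a1.ne'
    have d2 := (mul_eq_zero.1 c2).resolve_left a2.ne'
    have d3 := pow_eq_zero_iff (two_ne_zero) |>.1 d2
    refine ⟨pow_eq_zero_iff (two_ne_zero) |>.1 d1, ?_⟩
    have hp := Real.pi_pos
    exact (Real.cos_eq_one_iff_of_lt_of_lt (by linarith [hθ.1]) (by linarith [hθ.2])).1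
      (by linarith)
end

section
/- Let ω_c, ω_m > 0, N > 0, 0 ≤ κ < 1, and G > G_c := √(ω_m ω_c/(4(1−κ))). Define the classical potential E(α,θ) = (ω_c + 4κG²/ω_m)α² − 2G√N·α·sin θ + (ω_m N/2)(1 − cos θ) on ℝ × [−π/2,π/2]. Then the global minimum of E is attained exactly at the two symmetry-broken points (α₊,θ₊) and (α₋,θ₋) = (−α₊,−θ₊), where θ₊ = arccos(κ + ω_c ω_m/(4G²)) ∈ (0, π/2) and α₊ = (ω_m √N/(4G)) tan θ₊; in particular κ + ω_c ω_m/(4G²) < 1 so θ₊ is well-defined, and E(α₊,θ₊) < E(0,0) = 0. -/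
/-- The superradiant spin angle `θ₊ = arccos(κ + ω_c ω_m/(4G²))`. -/
noncomputable def θplus (ωc ωm κ G : ℝ) : ℝ :=
  Real.arccos (κ + ωc * ωm / (4 * G ^ 2))

/-- The superradiant photon displacement `α₊ = (ω_m √N/(4G)) tan θ₊`. -/
noncomputable def αplus (ωc ωm N κ G : ℝ) : ℝ :=
  ωm * Real.sqrt N / (4 * G) * Real.tan (θplus ωc ωm κ G)

theorem Ecl_square (ωc ωm N κ G α θ m : ℝ) (hωm : 0 < ωm) (hN : 0 < N) (hG : 0 < G)
    (hm : m = κ + ωc * ωm / (4 * G ^ 2)) (hm0 : 0 < m) :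
    Ecl ωc ωm N κ G α θ =
      4 * G ^ 2 * m / ωm * (α - ωm * Real.sqrt N / (4 * G) * (Real.sin θ / m)) ^ 2
      + ωm * N / (4 * m) * ((Real.cos θ - m) ^ 2 - (1 - m) ^ 2) := by
  have hA : ωc + 4 * κ * G ^ 2 / ωm = 4 * G ^ 2 * m / ωm := by
    rw [hm]; field_simp; ring
  have hs : Real.sqrt N ^ 2 = N := Real.sq_sqrt hN.le
  have hc : Real.sin θ ^ 2 = 1 - Real.cos θ ^ 2 := Real.sin_sq θ
  unfold Ecl
  rw [hA]
  have e : 4 * G ^ 2 * m / ωm * (α - ωm * Real.sqrt N / (4 * G) * (Real.sin θ / m)) ^ 2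
      = 4 * G ^ 2 * m / ωm * α ^ 2 - 2 * G * Real.sqrt N * α * Real.sin θ
        + ωm * Real.sqrt N ^ 2 * Real.sin θ ^ 2 / (4 * m) := by
    field_simp; ring
  rw [e, hs, hc]
  field_simp; ring

/-- For `0 ≤ κ < 1` and `G > G_c = √(ω_m ω_c/(4(1−κ)))`, one has
`κ + ω_c ω_m/(4G²) < 1`, `θ₊ ∈ (0, π/2)`, `E(α₊,θ₊) < E(0,0) = 0`, and the global
minimum of `E` on `ℝ × [−π/2,π/2]` is attained exactly at the two symmetry-broken
points `(α₊, θ₊)` and `(−α₊, −θ₊)`. -/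
theorem stmt15 (ωc ωm N κ G : ℝ) (hωc : 0 < ωc) (hωm : 0 < ωm) (hN : 0 < N)
    (hκ0 : 0 ≤ κ) (hκ1 : κ < 1) (hG : 0 < G)
    (hGc : Real.sqrt (ωm * ωc / (4 * (1 - κ))) < G) :
    κ + ωc * ωm / (4 * G ^ 2) < 1
      ∧ θplus ωc ωm κ G ∈ Set.Ioo 0 (Real.pi / 2)
      ∧ Ecl ωc ωm N κ G (αplus ωc ωm N κ G) (θplus ωc ωm κ G) < 0
      ∧ Ecl ωc ωm N κ G 0 0 = 0
      ∧ (∀ α θ : ℝ, θ ∈ Set.Icc (-(Real.pi / 2)) (Real.pi / 2) →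
          Ecl ωc ωm N κ G (αplus ωc ωm N κ G) (θplus ωc ωm κ G) ≤ Ecl ωc ωm N κ G α θ)
      ∧ (∀ α θ : ℝ, θ ∈ Set.Icc (-(Real.pi / 2)) (Real.pi / 2) →
          Ecl ωc ωm N κ G α θ = Ecl ωc ωm N κ G (αplus ωc ωm N κ G) (θplus ωc ωm κ G) →
          (α = αplus ωc ωm N κ G ∧ θ = θplus ωc ωm κ G)
            ∨ (α = -(αplus ωc ωm N κ G) ∧ θ = -(θplus ωc ωm κ G))) := by
  have h1 : κ + ωc * ωm / (4 * G ^ 2) < 1 := by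
    have h := (Real.sqrt_lt' hG).1 hGc
    have hk : 0 < 1 - κ := by linarith
    rw [div_lt_iff₀ (by positivity)] at h
    have : ωc * ωm / (4 * G ^ 2) < 1 - κ := by
      rw [div_lt_iff₀ (by positivity)]; nlinarith
    linarith
  have h0 : 0 < κ + ωc * ωm / (4 * G ^ 2) := by positivity
  obtain ⟨m, hm⟩ : ∃ m, m = κ + ωc * ωm / (4 * G ^ 2) := ⟨_, rfl⟩
  have hE := fun α θ => Ecl_square ωc ωm N κ G α θ m hωm hN hG hm (hm ▸ h0)
  have hθ : θplus ωc ωm κ G = Real.arccos m := by rw [hm]; rfl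
  have hcos : Real.cos (Real.arccos m) = m :=
    Real.cos_arccos (by rw [hm]; linarith) (by rw [hm]; linarith)
  have hα : αplus ωc ωm N κ G
      = ωm * Real.sqrt N / (4 * G) * (Real.sin (Real.arccos m) / m) := by
    unfold αplus
    rw [hθ, Real.tan_eq_sin_div_cos, hcos]
  rw [← hm] at h1 h0 ⊢
  have hmin : Ecl ωc ωm N κ G (αplus ωc ωm N κ G) (θplus ωc ωm κ G)
      = - (ωm * N / (4 * m) * (1 - m) ^ 2) := by
    rw [hE, hθ, hα, hcos]; ring
  have hB : 0 < ωm * N / (4 * m) := by positivity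
  have hA : 0 < 4 * G ^ 2 * m / ωm := by positivity
  refine ⟨h1, ?_, ?_, ?_, ?_, ?_⟩
  · rw [hθ]
    exact ⟨Real.arccos_pos.2 h1, Real.arccos_lt_pi_div_two.2 h0⟩
  · rw [hmin]
    have : 0 < (1 - m) ^ 2 := by
      have : 0 < 1 - m := by linarith
      positivity
    have := mul_pos hB this
    linarith
  · simp [Ecl]
  · intro α θ _
    rw [hmin, hE]
    have a := mul_nonneg hA.le
      (sq_nonneg (α - ωm * Real.sqrt N / (4 * G) * (Real.sin θ / m)))
    have b := mul_nonneg hB.le (sq_nonneg (Real.cos θ - m))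
    linarith
  · intro α θ ht heq
    rw [hmin, hE] at heq
    have a := mul_nonneg hA.le
      (sq_nonneg (α - ωm * Real.sqrt N / (4 * G) * (Real.sin θ / m)))
    have b := mul_nonneg hB.le (sq_nonneg (Real.cos θ - m))
    have a0 : 4 * G ^ 2 * m / ωm *
        (α - ωm * Real.sqrt N / (4 * G) * (Real.sin θ / m)) ^ 2 = 0 := by linarith
    have b0 : ωm * N / (4 * m) * (Real.cos θ - m) ^ 2 = 0 := by linarith
    have a1 : α - ωm * Real.sqrt N / (4 * G) * (Real.sin θ / m) = 0 :=
      pow_eq_zero_iff two_ne_zero |>.1 ((mul_eq_zero.1 a0).resolve_left hA.ne')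
    have b1 : Real.cos θ - m = 0 :=
      pow_eq_zero_iff two_ne_zero |>.1 ((mul_eq_zero.1 b0).resolve_left hB.ne')
    have b2 : m = Real.cos θ := by linarith
    have hpi := Real.pi_pos
    have habs : Real.arccos m = |θ| := by
      rw [b2, ← Real.cos_abs]
      exact Real.arccos_cos (abs_nonneg θ) (abs_le.2 ⟨by linarith [ht.1], by linarith [ht.2]⟩)
    rw [hα, hθ]
    rcases abs_choice θ with h | h
    · left
      rw [habs, h]
      exact ⟨by linarith, rfl⟩
    · right
      rw [habs, h, Real.sin_neg]
      refine ⟨?_, by ring⟩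
      rw [neg_div]
      linarith
end

section
/- Fix ω_c, ω_m > 0 and κ ≥ 0 with κ ≠ 1, and let f(G) be the zero-temperature QFI density of the squeezed Dicke model: with cos θ(G) = 1 if κ ≥ 1 or G ≤ G_c = √(ω_mω_c/(4(1−κ))), and cos θ(G) = κ + ω_cω_m/(4G²) otherwise; ω̃_c = ω_c + 4κG²/ω_m, ω̃_m = ω_m/cos θ(G), D = √((ω̃_cω_c − ω̃_m²)²/4 + 4G²ω_cω_m²/ω̃_m), Ω_± = √((ω̃_cω_c + ω̃_m²)/2 ± D), cos ζ = (ω̃_cω_c − ω̃_m²)/(2D), and f(G) = ω_m(sin²(ζ/2)/Ω₊ + cos²(ζ/2)/Ω₋)cos θ(G). Then: if 0 ≤ κ < 1, lim_{G→∞} f(G) = κ²/√(1−κ²); and if κ > 1, lim_{G→∞} f(G) = 1/√(1 − κ^{−1}). -/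
/-- `cos θ(G)`: `1` in the normal phase (`κ ≥ 1` or `G ≤ G_c`), and
`κ + ω_c ω_m/(4G²)` in the superradiant phase (`κ < 1` and `G > G_c`). -/
noncomputable def cosθ (ωc ωm κ G : ℝ) : ℝ :=
  if κ < 1 ∧ Real.sqrt (ωm * ωc / (4 * (1 - κ))) < G then κ + ωc * ωm / (4 * G ^ 2)
  else 1

/-- `ω̃_c = ω_c + 4κG²/ω_m`. -/
noncomputable def ωcTilde (ωc ωm κ G : ℝ) : ℝ := ωc + 4 * κ * G ^ 2 / ωm

/-- `ω̃_m = ω_m / cos θ(G)`. -/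
noncomputable def ωmTilde (ωc ωm κ G : ℝ) : ℝ := ωm / cosθ ωc ωm κ G

/-- `D = √((ω̃_c ω_c − ω̃_m²)²/4 + 4G²ω_c ω_m²/ω̃_m)`. -/
noncomputable def Dgap (ωc ωm κ G : ℝ) : ℝ :=
  Real.sqrt ((ωcTilde ωc ωm κ G * ωc - (ωmTilde ωc ωm κ G) ^ 2) ^ 2 / 4
    + 4 * G ^ 2 * ωc * ωm ^ 2 / ωmTilde ωc ωm κ G)

/-- Upper polariton frequency `Ω₊ = √((ω̃_c ω_c + ω̃_m²)/2 + D)`. -/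
noncomputable def Ωplus (ωc ωm κ G : ℝ) : ℝ :=
  Real.sqrt ((ωcTilde ωc ωm κ G * ωc + (ωmTilde ωc ωm κ G) ^ 2) / 2 + Dgap ωc ωm κ G)

/-- Lower polariton frequency `Ω₋ = √((ω̃_c ω_c + ω̃_m²)/2 − D)`. -/
noncomputable def Ωminus (ωc ωm κ G : ℝ) : ℝ :=
  Real.sqrt ((ωcTilde ωc ωm κ G * ωc + (ωmTilde ωc ωm κ G) ^ 2) / 2 - Dgap ωc ωm κ G)

/-- `cos ζ = (ω̃_c ω_c − ω̃_m²)/(2D)`. -/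
noncomputable def cosζ (ωc ωm κ G : ℝ) : ℝ :=
  (ωcTilde ωc ωm κ G * ωc - (ωmTilde ωc ωm κ G) ^ 2) / (2 * Dgap ωc ωm κ G)

/-- The zero-temperature QFI density of the squeezed Dicke model:
`f(G) = ω_m (sin²(ζ/2)/Ω₊ + cos²(ζ/2)/Ω₋) cos θ(G)`, where
`sin²(ζ/2) = (1 − cos ζ)/2` and `cos²(ζ/2) = (1 + cos ζ)/2`. -/
noncomputable def fQ (ωc ωm κ G : ℝ) : ℝ :=
  ωm * ((1 - cosζ ωc ωm κ G) / 2 / Ωplus ωc ωm κ G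
    + (1 + cosζ ωc ωm κ G) / 2 / Ωminus ωc ωm κ G) * cosθ ωc ωm κ G

open Filter Topology

lemma core_id (A B C : ℝ) (hA : 0 < A) (hB : 0 < B) (hC : 0 < C) (h : C < A * B) :
    (1 - (A - B) / (2 * √((A - B) ^ 2 / 4 + C))) / 2 / √((A + B) / 2 + √((A - B) ^ 2 / 4 + C))
    + (1 + (A - B) / (2 * √((A - B) ^ 2 / 4 + C))) / 2 / √((A + B) / 2 - √((A - B) ^ 2 / 4 + C))
    = (A + √(A * B - C)) / (√(A * B - C) * √(A + B + 2 * √(A * B - C))) := by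
  have hD0 : 0 < (A - B) ^ 2 / 4 + C := by positivity
  have hD : 0 < √((A - B) ^ 2 / 4 + C) := Real.sqrt_pos.2 hD0
  have hD2 := Real.sq_sqrt hD0.le
  set D := √((A - B) ^ 2 / 4 + C) with hDdef
  have hlt : D < (A + B) / 2 := by
    apply lt_of_pow_lt_pow_left₀ 2 (by positivity)
    rw [hD2]; nlinarith
  have hp0 : 0 < (A + B) / 2 + D := by positivity
  have hm0 : 0 < (A + B) / 2 - D := by linarith
  have hp := Real.sqrt_pos.2 hp0
  have hm := Real.sqrt_pos.2 hm0
  have hp2 := Real.sq_sqrt hp0.le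
  have hm2 := Real.sq_sqrt hm0.le
  set p := √((A + B) / 2 + D)
  set m := √((A + B) / 2 - D)
  have hs : √(A * B - C) = p * m := by
    rw [Real.sqrt_eq_iff_mul_self_eq (by linarith) (by positivity)]
    have : p * m * (p * m) = p ^ 2 * m ^ 2 := by ring
    rw [this, hp2, hm2]; linarith
  have ht : √(A + B + 2 * (p * m)) = p + m := by
    rw [Real.sqrt_eq_iff_mul_self_eq (by positivity) (by positivity)]
    linarith
  rw [hs, ht]
  have hA' : A = (p ^ 2 + m ^ 2) / 2 + (A - B) / 2 := by linarith
  have hDe : D = (p ^ 2 - m ^ 2) / 2 := by linarith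
  have hne : p - m ≠ 0 := by
    intro h0
    have : p = m := by linarith
    rw [this] at hDe; linarith
  have hx : (A - B) / (2 * D) = (A - B) / ((p + m) * (p - m)) := by
    rw [hDe]; congr 1; ring
  rw [hx]
  generalize A - B = d at *
  rw [hA']
  have : p + m ≠ 0 := by positivity
  field_simp
  ring

lemma fQ_eq (ωc ωm κ G : ℝ) (hωm : 0 < ωm) (A B C c : ℝ) (hc : cosθ ωc ωm κ G = c)
    (hc0 : 0 < c)
    (hAe : (ωc + 4 * κ * G ^ 2 / ωm) * ωc = A) (hBe : (ωm / c) ^ 2 = B)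
    (hCe : 4 * G ^ 2 * ωc * ωm * c = C)
    (hA : 0 < A) (hB : 0 < B) (hC : 0 < C) (h : C < A * B) :
    fQ ωc ωm κ G = ωm * ((A + √(A * B - C)) / (√(A * B - C) * √(A + B + 2 * √(A * B - C)))) * c := by
  have hCe' : 4 * G ^ 2 * ωc * ωm ^ 2 / (ωm / c) = C := by
    rw [← hCe]; field_simp
  rw [← core_id A B C hA hB hC h]
  simp only [fQ, cosζ, Ωplus, Ωminus, Dgap, ωmTilde, ωcTilde, hc, hAe, hBe, hCe']

lemma lim_gen (ωm : ℝ) (f a b v c : ℝ → ℝ) (a0 b0 v0 c0 : ℝ) (ha0 : 0 < a0) (hv0 : 0 < v0)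
    (ha : Tendsto a atTop (𝓝 a0)) (hb : Tendsto b atTop (𝓝 b0)) (hv : Tendsto v atTop (𝓝 v0))
    (hc : Tendsto c atTop (𝓝 c0))
    (hf : ∀ᶠ G in atTop, f G = ωm * ((G ^ 2 * a G + √(G ^ 2 * v G)) /
      (√(G ^ 2 * v G) * √(G ^ 2 * a G + b G + 2 * √(G ^ 2 * v G)))) * c G) :
    Tendsto f atTop (𝓝 (ωm * (a0 / (√v0 * √a0)) * c0)) := by
  have hu : Tendsto (fun G : ℝ => G⁻¹) atTop (𝓝 0) := tendsto_inv_atTop_zero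
  have hs := hv.sqrt
  have hsu := hs.mul hu
  have hnum := ha.add hsu
  have hden := hs.mul ((ha.add ((hb.mul (hu.pow 2)).add (hsu.const_mul 2))).sqrt)
  have h1 : √v0 * √(a0 + (b0 * 0 ^ 2 + 2 * (√v0 * 0))) ≠ 0 := by
    have : a0 + (b0 * 0 ^ 2 + 2 * (√v0 * 0)) = a0 := by ring
    rw [this]; positivity
  have key := ((hnum.div hden h1).const_mul ωm).mul hc
  have e : ωm * ((a0 + √v0 * 0) / (√v0 * √(a0 + (b0 * 0 ^ 2 + 2 * (√v0 * 0))))) * c0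
      = ωm * (a0 / (√v0 * √a0)) * c0 := by simp
  rw [e] at key
  refine key.congr' ?_
  filter_upwards [hf, eventually_gt_atTop 0] with G h hG
  rw [h]
  have e1 : √(G ^ 2 * v G) = G * √(v G) := by
    rw [Real.sqrt_mul (by positivity), Real.sqrt_sq hG.le]
  have e2 : G ^ 2 * a G + b G + 2 * (G * √(v G))
      = G ^ 2 * (a G + (b G * G⁻¹ ^ 2 + 2 * (√(v G) * G⁻¹))) := by
    field_simp; try ring
  rw [e1, e2, Real.sqrt_mul (by positivity), Real.sqrt_sq hG.le]
  have e3 : G ^ 2 * a G + G * √(v G) = G ^ 2 * (a G + √(v G) * G⁻¹) := by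
    field_simp
  rw [e3]
  congr 2
  simp only [Pi.div_apply]
  rw [show G * √(v G) * (G * √(a G + (b G * G⁻¹ ^ 2 + 2 * (√(v G) * G⁻¹))))
    = G ^ 2 * (√(v G) * √(a G + (b G * G⁻¹ ^ 2 + 2 * (√(v G) * G⁻¹)))) by ring]
  rw [mul_div_mul_left _ _ (by positivity)]

lemma inv_sq_lim (k : ℝ) : Tendsto (fun G : ℝ => k / (4 * G ^ 2)) atTop (𝓝 0) := by
  have hu : Tendsto (fun G : ℝ => G⁻¹) atTop (𝓝 0) := tendsto_inv_atTop_zero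
  have := (hu.pow 2).const_mul (k / 4)
  simp only [ne_eq, OfNat.ofNat_ne_zero, not_false_eq_true, zero_pow, mul_zero] at this
  refine this.congr fun G => ?_
  rw [inv_pow]; ring

lemma cos_lim (k κ : ℝ) : Tendsto (fun G : ℝ => κ + k / (4 * G ^ 2)) atTop (𝓝 κ) := by
  simpa using (inv_sq_lim k).const_add κ

lemma fQ_sr (ωc ωm κ : ℝ) (hωc : 0 < ωc) (hωm : 0 < ωm) (hκ : 0 ≤ κ) (h1 : κ < 1) :
    ∀ᶠ G in atTop, fQ ωc ωm κ G =
      ωm * ((G ^ 2 * (4 * ωc * (κ + ωc * ωm / (4 * G ^ 2)) / ωm)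
          + √(G ^ 2 * (4 * ωc * ωm * ((κ + ωc * ωm / (4 * G ^ 2))⁻¹ - (κ + ωc * ωm / (4 * G ^ 2)))))) /
      (√(G ^ 2 * (4 * ωc * ωm * ((κ + ωc * ωm / (4 * G ^ 2))⁻¹ - (κ + ωc * ωm / (4 * G ^ 2)))))
       * √(G ^ 2 * (4 * ωc * (κ + ωc * ωm / (4 * G ^ 2)) / ωm) + (ωm / (κ + ωc * ωm / (4 * G ^ 2))) ^ 2
        + 2 * √(G ^ 2 * (4 * ωc * ωm * ((κ + ωc * ωm / (4 * G ^ 2))⁻¹ - (κ + ωc * ωm / (4 * G ^ 2))))))))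
      * (κ + ωc * ωm / (4 * G ^ 2)) := by
  filter_upwards [eventually_gt_atTop 0, eventually_gt_atTop (√(ωm * ωc / (4 * (1 - κ)))),
    (cos_lim (ωc * ωm) κ).eventually (gt_mem_nhds h1)] with G hG hGc hlt
  have hc : cosθ ωc ωm κ G = κ + ωc * ωm / (4 * G ^ 2) := by
    rw [cosθ, if_pos ⟨h1, hGc⟩]
  have hc0 : 0 < κ + ωc * ωm / (4 * G ^ 2) := by positivity
  have hAe : (ωc + 4 * κ * G ^ 2 / ωm) * ωc = G ^ 2 * (4 * ωc * (κ + ωc * ωm / (4 * G ^ 2)) / ωm) := by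
    field_simp; try ring
  generalize κ + ωc * ωm / (4 * G ^ 2) = c at *
  have hv : G ^ 2 * (4 * ωc * ωm * (c⁻¹ - c))
     = G ^ 2 * (4 * ωc * c / ωm) * (ωm / c) ^ 2 - 4 * G ^ 2 * ωc * ωm * c := by
    field_simp; try ring
  have hcc : c < c⁻¹ := hlt.trans ((one_lt_inv₀ hc0).2 hlt)
  have hpos : 0 < G ^ 2 * (4 * ωc * ωm * (c⁻¹ - c)) := by
    have : 0 < c⁻¹ - c := by linarith
    positivity
  rw [fQ_eq ωc ωm κ G hωm _ _ _ c hc hc0 hAe rfl rfl (by positivity) (by positivity) (by positivity)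
    (by linarith), ← hv]

lemma fQ_np (ωc ωm κ : ℝ) (hωc : 0 < ωc) (hωm : 0 < ωm) (h1 : 1 < κ) :
    ∀ᶠ G in atTop, fQ ωc ωm κ G =
      ωm * ((G ^ 2 * (4 * κ * ωc / ωm + 4 * ωc ^ 2 / (4 * G ^ 2))
          + √(G ^ 2 * (4 * (κ - 1) * ωc * ωm + 4 * ωc ^ 2 * ωm ^ 2 / (4 * G ^ 2)))) /
      (√(G ^ 2 * (4 * (κ - 1) * ωc * ωm + 4 * ωc ^ 2 * ωm ^ 2 / (4 * G ^ 2)))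
       * √(G ^ 2 * (4 * κ * ωc / ωm + 4 * ωc ^ 2 / (4 * G ^ 2)) + ωm ^ 2
        + 2 * √(G ^ 2 * (4 * (κ - 1) * ωc * ωm + 4 * ωc ^ 2 * ωm ^ 2 / (4 * G ^ 2))))))
      * 1 := by
  filter_upwards [eventually_gt_atTop 0] with G hG
  have hc : cosθ ωc ωm κ G = 1 := by
    rw [cosθ, if_neg]; intro h; linarith [h.1]
  have hk : 0 < κ - 1 := by linarith
  have hk0 : 0 < κ := by linarith
  have hAe : (ωc + 4 * κ * G ^ 2 / ωm) * ωc = G ^ 2 * (4 * κ * ωc / ωm + 4 * ωc ^ 2 / (4 * G ^ 2)) := by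
    field_simp; try ring
  have hv : G ^ 2 * (4 * (κ - 1) * ωc * ωm + 4 * ωc ^ 2 * ωm ^ 2 / (4 * G ^ 2))
     = G ^ 2 * (4 * κ * ωc / ωm + 4 * ωc ^ 2 / (4 * G ^ 2)) * ωm ^ 2 - 4 * G ^ 2 * ωc * ωm * 1 := by
    field_simp; try ring
  have hpos : 0 < G ^ 2 * (4 * (κ - 1) * ωc * ωm + 4 * ωc ^ 2 * ωm ^ 2 / (4 * G ^ 2)) := by
    positivity
  rw [fQ_eq ωc ωm κ G hωm _ (ωm ^ 2) _ 1 hc one_pos hAe (by simp) rfl (by positivity) (by positivity)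
    (by positivity) (by linarith), ← hv]

lemma lim_zero (ωc ωm : ℝ) (hωc : 0 < ωc) (hωm : 0 < ωm) :
    Tendsto (fun G => fQ ωc ωm 0 G) atTop (𝓝 0) := by
  have hb : Tendsto (fun G : ℝ => ωm * (2 / ωc) * (0 + ωc * ωm / (4 * G ^ 2))) atTop (𝓝 0) := by
    simpa using (cos_lim (ωc * ωm) 0).const_mul (ωm * (2 / ωc))
  have hG2 : Tendsto (fun G : ℝ => G ^ 2) atTop atTop := tendsto_pow_atTop two_ne_zero
  have key : ∀ᶠ G in atTop, 0 ≤ fQ ωc ωm 0 G ∧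
      fQ ωc ωm 0 G ≤ ωm * (2 / ωc) * (0 + ωc * ωm / (4 * G ^ 2)) := by
    filter_upwards [fQ_sr ωc ωm 0 hωc hωm le_rfl one_pos, eventually_gt_atTop 0,
      hG2.eventually_ge_atTop (ωc ^ 2), hG2.eventually_ge_atTop (ωc * ωm)] with G h hG h1 h2
    have hAe : G ^ 2 * (4 * ωc * (0 + ωc * ωm / (4 * G ^ 2)) / ωm) = ωc ^ 2 := by
      field_simp; try ring
    have hv : G ^ 2 * (4 * ωc * ωm * ((0 + ωc * ωm / (4 * G ^ 2))⁻¹ - (0 + ωc * ωm / (4 * G ^ 2))))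
       = 16 * (G ^ 2) ^ 2 - (ωc * ωm) ^ 2 := by
      rw [zero_add]; field_simp; try ring
    rw [hAe, hv] at h
    have hs : ωc ^ 2 ≤ √(16 * (G ^ 2) ^ 2 - (ωc * ωm) ^ 2) := by
      apply Real.le_sqrt_of_sq_le
      have i1 := pow_le_pow_left₀ (by positivity) h1 2
      have i2 := pow_le_pow_left₀ (by positivity) h2 2
      have : 0 < (G ^ 2) ^ 2 := by positivity
      linarith
    set s := √(16 * (G ^ 2) ^ 2 - (ωc * ωm) ^ 2)
    have hs0 : 0 < s := lt_of_lt_of_le (by positivity) hs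
    have hc0 : 0 < 0 + ωc * ωm / (4 * G ^ 2) := by positivity
    generalize 0 + ωc * ωm / (4 * G ^ 2) = c at *
    have hr : ωc ≤ √(ωc ^ 2 + (ωm / c) ^ 2 + 2 * s) := by
      apply Real.le_sqrt_of_sq_le
      have : 0 < (ωm / c) ^ 2 := by positivity
      linarith
    refine ⟨by rw [h]; positivity, ?_⟩
    rw [h]
    refine mul_le_mul_of_nonneg_right (mul_le_mul_of_nonneg_left ?_ hωm.le) hc0.le
    rw [div_le_div_iff₀ (by positivity) hωc]
    calc (ωc ^ 2 + s) * ωc ≤ (s + s) * √(ωc ^ 2 + (ωm / c) ^ 2 + 2 * s) := by gcongr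
      _ = _ := by ring
  exact tendsto_of_tendsto_of_tendsto_of_le_of_le' tendsto_const_nhds hb
    (key.mono fun _ h => h.1) (key.mono fun _ h => h.2)

/-- the large-coupling limits of the zero-temperature QFI density
of the squeezed Dicke model: `κ²/√(1−κ²)` for `0 ≤ κ < 1`, and `1/√(1 − κ⁻¹)`
for `κ > 1`. -/
theorem stmt17 (ωc ωm κ : ℝ) (hωc : 0 < ωc) (hωm : 0 < ωm) (hκ : 0 ≤ κ)
    (hκne : κ ≠ 1) :
    (κ < 1 → Tendsto (fun G => fQ ωc ωm κ G) atTop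
        (𝓝 (κ ^ 2 / Real.sqrt (1 - κ ^ 2))))
      ∧ (1 < κ → Tendsto (fun G => fQ ωc ωm κ G) atTop
        (𝓝 (1 / Real.sqrt (1 - κ⁻¹)))) := by
  constructor
  · intro h1
    rcases hκ.eq_or_lt with h0 | h0
    · subst h0
      simpa using lim_zero ωc ωm hωc hωm
    · have hc := cos_lim (ωc * ωm) κ
      have hlt : κ < κ⁻¹ := h1.trans ((one_lt_inv₀ h0).2 h1)
      have hd : 0 < κ⁻¹ - κ := by linarith
      have := lim_gen ωm (fun G => fQ ωc ωm κ G) _ _ _ _ (4 * ωc * κ / ωm) ((ωm / κ) ^ 2)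
        (4 * ωc * ωm * (κ⁻¹ - κ)) κ (by positivity) (by positivity)
        ((hc.const_mul (4 * ωc)).div_const ωm) ((tendsto_const_nhds.div hc h0.ne').pow 2)
        (((hc.inv₀ h0.ne').sub hc).const_mul (4 * ωc * ωm)) hc
        (fQ_sr ωc ωm κ hωc hωm hκ h1)
      convert this using 2
      have h3 : 0 < 1 - κ ^ 2 := by nlinarith
      rw [← Real.sqrt_mul (by positivity)]
      have e : 4 * ωc * ωm * (κ⁻¹ - κ) * (4 * ωc * κ / ωm) = (4 * ωc) ^ 2 * (1 - κ ^ 2) := by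
        field_simp
      rw [e, Real.sqrt_mul (by positivity), Real.sqrt_sq (by positivity)]
      have := Real.sqrt_pos.2 h3
      field_simp
  · intro h1
    have hk : 0 < κ - 1 := by linarith
    have hk0 : 0 < κ := by linarith
    have := lim_gen ωm (fun G => fQ ωc ωm κ G) _ (fun _ => ωm ^ 2) _ (fun _ => 1)
        (4 * κ * ωc / ωm) (ωm ^ 2)
        (4 * (κ - 1) * ωc * ωm) 1 (by positivity) (by positivity)
        (cos_lim _ _) tendsto_const_nhds (cos_lim _ _) tendsto_const_nhds
        (fQ_np ωc ωm κ hωc hωm h1)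
    convert this using 2
    rw [← Real.sqrt_mul (by positivity)]
    have e : 4 * (κ - 1) * ωc * ωm * (4 * κ * ωc / ωm) = (4 * ωc * κ) ^ 2 * (1 - κ⁻¹) := by
      field_simp
    have h3 : 0 < 1 - κ⁻¹ := by
      have := inv_lt_one_of_one_lt₀ h1
      linarith
    rw [e, Real.sqrt_mul (by positivity), Real.sqrt_sq (by positivity)]
    have := Real.sqrt_pos.2 h3
    field_simp
end

section
/- Fix ω_c, ω_m > 0 and 0 ≤ κ < 1, let G_c = √(ω_mω_c/(4(1−κ))), and let f(G) be the zero-temperature QFI density of the squeezed Dicke model: with cos θ(G) = 1 for G ≤ G_c and cos θ(G) = κ + ω_cω_m/(4G²) for G > G_c; ω̃_c = ω_c + 4κG²/ω_m, ω̃_m = ω_m/cos θ(G), D = √((ω̃_cω_c − ω̃_m²)²/4 + 4G²ω_cω_m²/ω̃_m), Ω_± = √((ω̃_cω_c + ω̃_m²)/2 ± D), cos ζ = (ω̃_cω_c − ω̃_m²)/(2D), and f(G) = ω_m(sin²(ζ/2)/Ω₊ + cos²(ζ/2)/Ω₋)cos θ(G). Then f diverges at the critical point with exponent −1/2: there exist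 constants L₋ > 0 and L₊ > 0 such that lim_{G→G_c⁻} f(G)·√(G_c − G) = L₋ and lim_{G→G_c⁺} f(G)·√(G − G_c) = L₊. -/
open Filter Topology

theorem aux_core {l : Filter ℝ} (A B C Δ h c : ℝ → ℝ) (w a b c0 h0 : ℝ) (hw : 0 < w)
    (ha : 0 < a) (hb : 0 < b) (hc0 : 0 < c0) (hh0 : 0 < h0)
    (hA : Tendsto A l (𝓝 a)) (hB : Tendsto B l (𝓝 b)) (hC : Tendsto C l (𝓝 c0))
    (hΔ : Tendsto Δ l (𝓝 0)) (hh : Tendsto h l (𝓝 h0)) (hc : Tendsto c l (𝓝 1))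
    (hpos : ∀ᶠ x in l, 0 < Δ x) (heq : ∀ᶠ x in l, A x * B x - C x = Δ x * h x) :
    ∃ L : ℝ, 0 < L ∧ Tendsto (fun x =>
      w * ((1 - (A x - B x) / (2 * Real.sqrt ((A x - B x) ^ 2 / 4 + C x))) / 2
          / Real.sqrt ((A x + B x) / 2 + Real.sqrt ((A x - B x) ^ 2 / 4 + C x))
        + (1 + (A x - B x) / (2 * Real.sqrt ((A x - B x) ^ 2 / 4 + C x))) / 2
          / Real.sqrt ((A x + B x) / 2 - Real.sqrt ((A x - B x) ^ 2 / 4 + C x))) * c x * Real.sqrt (Δ x)) l (𝓝 L) := by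
  have hD : Tendsto (fun x => Real.sqrt ((A x - B x) ^ 2 / 4 + C x)) l (𝓝 (Real.sqrt ((a - b) ^ 2 / 4 + c0))) :=
    ((((hA.sub hB).pow 2).div_const 4).add hC).sqrt
  have hd0 : 0 < Real.sqrt ((a - b) ^ 2 / 4 + c0) := Real.sqrt_pos.2 (by positivity)
  have hdsq : Real.sqrt ((a - b) ^ 2 / 4 + c0) ^ 2 = (a - b) ^ 2 / 4 + c0 := Real.sq_sqrt (by positivity)
  set d := Real.sqrt ((a - b) ^ 2 / 4 + c0) with hd
  have hP : Tendsto (fun x => Real.sqrt ((A x + B x) / 2 + Real.sqrt ((A x - B x) ^ 2 / 4 + C x))) l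
      (𝓝 (Real.sqrt ((a + b) / 2 + d))) := (((hA.add hB).div_const 2).add hD).sqrt
  have hp0 : 0 < Real.sqrt ((a + b) / 2 + d) := Real.sqrt_pos.2 (by positivity)
  have hZ : Tendsto (fun x => (A x - B x) / (2 * Real.sqrt ((A x - B x) ^ 2 / 4 + C x))) l
      (𝓝 ((a - b) / (2 * d))) := (hA.sub hB).div (hD.const_mul 2) (by positivity)
  have hz : 0 < 1 + (a - b) / (2 * d) := by
    have h1 : -(2 * d) < a - b := by
      by_contra hcon
      push Not at hcon
      nlinarith
    have h2 : 1 + (a - b) / (2 * d) = (2 * d + (a - b)) / (2 * d) := by field_simp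
    rw [h2]
    apply div_pos <;> linarith
  refine ⟨w * ((1 - (a - b) / (2 * d)) / 2 / Real.sqrt ((a + b) / 2 + d) * Real.sqrt 0
    + (1 + (a - b) / (2 * d)) / 2 * (Real.sqrt ((a + b) / 2 + d) / (Real.sqrt h0))) * 1, ?_, ?_⟩
  · have : 0 < (Real.sqrt h0) := Real.sqrt_pos.2 hh0
    rw [Real.sqrt_zero, mul_zero, zero_add]
    positivity
  · have hlim := ((((((tendsto_const_nhds (x := (1:ℝ))).sub hZ).div_const 2).div hP hp0.ne').mul
      hΔ.sqrt).add ((((tendsto_const_nhds (x := (1:ℝ))).add hZ).div_const 2).mul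
        (hP.div hh.sqrt (Real.sqrt_pos.2 hh0).ne')))
    refine ((hlim.const_mul w).mul hc).congr' ?_
    filter_upwards [hpos, heq, hh.eventually (lt_mem_nhds hh0), hA.eventually (lt_mem_nhds ha),
      hB.eventually (lt_mem_nhds hb), hC.eventually (lt_mem_nhds hc0)] with x h1 h2 h3 h4 h5 h6
    simp only [Pi.div_apply]
    have hDs : Real.sqrt ((A x - B x) ^ 2 / 4 + C x) ^ 2 = (A x - B x) ^ 2 / 4 + C x :=
      Real.sq_sqrt (by positivity)
    have hDp : 0 < Real.sqrt ((A x - B x) ^ 2 / 4 + C x) := Real.sqrt_pos.2 (by positivity)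
    set D := Real.sqrt ((A x - B x) ^ 2 / 4 + C x)
    have hpp : 0 < (A x + B x) / 2 + D := by positivity
    have hm : (A x + B x) / 2 - D = Δ x * h x / ((A x + B x) / 2 + D) := by
      rw [eq_div_iff hpp.ne', ← h2]
      linear_combination -hDs
    rw [hm, Real.sqrt_div (by positivity), Real.sqrt_mul h1.le]
    have q1 := Real.sqrt_pos.2 h1
    have q2 := Real.sqrt_pos.2 h3
    have q3 := Real.sqrt_pos.2 hpp
    generalize (A x - B x) / (2 * D) = z
    field_simp

theorem aux_fQ {l : Filter ℝ} (ωc ωm κ g : ℝ) (hωc : 0 < ωc) (hωm : 0 < ωm) (hκ0 : 0 ≤ κ)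
    (hg : 0 < g) (Δ h : ℝ → ℝ) (h0 : ℝ) (hh0 : 0 < h0) (hG : Tendsto (fun G : ℝ => G) l (𝓝 g))
    (hΔ : Tendsto Δ l (𝓝 0)) (hh : Tendsto h l (𝓝 h0))
    (hc : Tendsto (cosθ ωc ωm κ) l (𝓝 1))
    (hpos : ∀ᶠ x in l, 0 < Δ x)
    (heq : ∀ᶠ x in l, (ωc + 4 * κ * x ^ 2 / ωm) * ωc * (ωm / cosθ ωc ωm κ x) ^ 2
      - 4 * x ^ 2 * ωc * ωm ^ 2 / (ωm / cosθ ωc ωm κ x) = Δ x * h x) :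
    ∃ L : ℝ, 0 < L ∧ Tendsto (fun G => fQ ωc ωm κ G * Real.sqrt (Δ G)) l (𝓝 L) := by
  have hm : Tendsto (fun G => ωm / cosθ ωc ωm κ G) l (𝓝 (ωm / 1)) :=
    tendsto_const_nhds.div hc one_ne_zero
  exact aux_core (fun G => (ωc + 4 * κ * G ^ 2 / ωm) * ωc) (fun G => (ωm / cosθ ωc ωm κ G) ^ 2)
    (fun G => 4 * G ^ 2 * ωc * ωm ^ 2 / (ωm / cosθ ωc ωm κ G)) Δ h (cosθ ωc ωm κ) ωm
    ((ωc + 4 * κ * g ^ 2 / ωm) * ωc) ((ωm / 1) ^ 2) (4 * g ^ 2 * ωc * ωm ^ 2 / (ωm / 1)) h0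
    hωm (by positivity) (by positivity) (by positivity) hh0
    (((((hG.pow 2).const_mul (4 * κ)).div_const ωm).const_add ωc).mul_const ωc)
    (hm.pow 2)
    (((((hG.pow 2).const_mul 4).mul_const ωc).mul_const (ωm ^ 2)).div hm (by positivity))
    hΔ hh hc hpos heq

/-- the zero-temperature QFI density of the squeezed Dicke model
diverges at the critical point `G_c = √(ω_m ω_c/(4(1−κ)))` with exponent `−1/2`:
there are constants `L₋ > 0`, `L₊ > 0` with `f(G)·√(G_c − G) → L₋` as `G → G_c⁻`
and `f(G)·√(G − G_c) → L₊` as `G → G_c⁺`. -/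
theorem stmt18 (ωc ωm κ : ℝ) (hωc : 0 < ωc) (hωm : 0 < ωm) (hκ0 : 0 ≤ κ)
    (hκ1 : κ < 1) :
    (∃ Lm : ℝ, 0 < Lm ∧
      Tendsto (fun G => fQ ωc ωm κ G
          * Real.sqrt (Real.sqrt (ωm * ωc / (4 * (1 - κ))) - G))
        (𝓝[<] Real.sqrt (ωm * ωc / (4 * (1 - κ)))) (𝓝 Lm))
    ∧ (∃ Lp : ℝ, 0 < Lp ∧
      Tendsto (fun G => fQ ωc ωm κ G
          * Real.sqrt (G - Real.sqrt (ωm * ωc / (4 * (1 - κ)))))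
        (𝓝[>] Real.sqrt (ωm * ωc / (4 * (1 - κ)))) (𝓝 Lp)) := by
  have hk : 0 < 1 - κ := by linarith
  have hg : 0 < Real.sqrt (ωm * ωc / (4 * (1 - κ))) := Real.sqrt_pos.2 (by positivity)
  have hgs : Real.sqrt (ωm * ωc / (4 * (1 - κ))) ^ 2 = ωm * ωc / (4 * (1 - κ)) :=
    Real.sq_sqrt (by positivity)
  have hcL : ∀ G, G < Real.sqrt (ωm * ωc / (4 * (1 - κ))) → cosθ ωc ωm κ G = 1 := by
    intro G hG
    unfold cosθ
    rw [if_neg]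
    rintro ⟨-, h⟩
    exact absurd h (not_lt.2 hG.le)
  have hcR : ∀ G, Real.sqrt (ωm * ωc / (4 * (1 - κ))) < G →
      cosθ ωc ωm κ G = κ + ωc * ωm / (4 * G ^ 2) := by
    intro G hG
    unfold cosθ
    rw [if_pos ⟨hκ1, hG⟩]
  generalize Real.sqrt (ωm * ωc / (4 * (1 - κ))) = g at *
  have hgs' : ωm * ωc = 4 * (1 - κ) * g ^ 2 := by
    rw [hgs]; field_simp
  have hGl : Tendsto (fun G : ℝ => G) (𝓝[<] g) (𝓝 g) := tendsto_nhdsWithin_of_tendsto_nhds tendsto_id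
  have hGr : Tendsto (fun G : ℝ => G) (𝓝[>] g) (𝓝 g) := tendsto_nhdsWithin_of_tendsto_nhds tendsto_id
  constructor
  · refine aux_fQ ωc ωm κ g hωc hωm hκ0 hg (fun G => g - G)
      (fun G => ωc * ωm * (4 * (1 - κ)) * (g + G)) (ωc * ωm * (4 * (1 - κ)) * (g + g))
      (by positivity) hGl ?_ ((hGl.const_add g).const_mul _) ?_ ?_ ?_
    · simpa using hGl.const_sub g
    · refine tendsto_const_nhds.congr' ?_
      filter_upwards [self_mem_nhdsWithin] with G hG
      exact (hcL G hG).symm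
    · filter_upwards [self_mem_nhdsWithin] with G hG
      exact sub_pos.2 hG
    · filter_upwards [self_mem_nhdsWithin] with G hG
      rw [hcL G hG]
      field_simp
      linear_combination hgs'
  · have hc : Tendsto (cosθ ωc ωm κ) (𝓝[>] g) (𝓝 1) := by
      have h1 : Tendsto (fun G : ℝ => κ + ωc * ωm / (4 * G ^ 2)) (𝓝[>] g)
          (𝓝 (κ + ωc * ωm / (4 * g ^ 2))) :=
        (tendsto_const_nhds.div ((hGr.pow 2).const_mul 4) (by positivity)).const_add κ
      have h2 : κ + ωc * ωm / (4 * g ^ 2) = 1 := by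
        rw [mul_comm ωc ωm, hgs']; field_simp; ring
      rw [h2] at h1
      refine h1.congr' ?_
      filter_upwards [self_mem_nhdsWithin] with G hG
      exact (hcR G hG).symm
    refine aux_fQ ωc ωm κ g hωc hωm hκ0 hg (fun G => G - g)
      (fun G => ωc * ωm * (4 * (1 - κ)) * (1 + cosθ ωc ωm κ G) * (G + g) / cosθ ωc ωm κ G)
      (ωc * ωm * (4 * (1 - κ)) * (1 + 1) * (g + g) / 1)
      (by positivity) hGr ?_
      ((((hc.const_add 1).const_mul _).mul (hGr.add_const g)).div hc one_ne_zero) hc ?_ ?_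
    · simpa using hGr.sub_const g
    · filter_upwards [self_mem_nhdsWithin] with G hG
      exact sub_pos.2 hG
    · filter_upwards [self_mem_nhdsWithin] with G hG
      have hG0 : 0 < G := hg.trans hG
      have e : 4 * G ^ 2 * cosθ ωc ωm κ G = 4 * G ^ 2 * κ + ωc * ωm := by
        rw [hcR G hG]; field_simp
      have hcp : 0 < cosθ ωc ωm κ G := by
        rw [hcR G hG]; positivity
      generalize cosθ ωc ωm κ G = c at *
      have e2 : 4 * G ^ 2 * (1 - c) = 4 * (1 - κ) * (G ^ 2 - g ^ 2) := by
        linear_combination -e - hgs'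
      field_simp
      linear_combination -e + (c * (1 + c)) * e2
end

section
/- Fix ω_c, ω_m > 0 and 0 ≤ κ < 1. For G > 0, define the normal-phase lower polariton frequency squared Ω₋²(G) = (ω̃_c ω_c + ω_m²)/2 − √((ω̃_c ω_c − ω_m²)²/4 + 4G²ω_cω_m), where ω̃_c = ω_c + 4κG²/ω_m. Then Ω₋²(G) = 0 if and only if G = G_c := √(ω_mω_c/(4(1−κ))); moreover Ω₋²(G) > 0 for 0 < G < G_c. Thus the lower polariton mode softens to zero exactly at the superradiant critical coupling. -/
/-- The normal-phase lower polariton frequency squared of the squeezed Dicke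
model: `Ω₋²(G) = (ω̃_c ω_c + ω_m²)/2 − √((ω̃_c ω_c − ω_m²)²/4 + 4G²ω_c ω_m)`
with `ω̃_c = ω_c + 4κG²/ω_m`. -/
noncomputable def Ωminus2 (ωc ωm κ G : ℝ) : ℝ :=
  ((ωc + 4 * κ * G ^ 2 / ωm) * ωc + ωm ^ 2) / 2
    - Real.sqrt (((ωc + 4 * κ * G ^ 2 / ωm) * ωc - ωm ^ 2) ^ 2 / 4
        + 4 * G ^ 2 * ωc * ωm)

/-- for `0 ≤ κ < 1` and `G > 0`, the lower polariton mode softens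
to zero exactly at the superradiant critical coupling:
`Ω₋²(G) = 0 ↔ G = G_c = √(ω_m ω_c/(4(1−κ)))`, and `Ω₋²(G) > 0` for
`0 < G < G_c`. -/
theorem stmt19 (ωc ωm κ : ℝ) (hωc : 0 < ωc) (hωm : 0 < ωm)
    (hκ0 : 0 ≤ κ) (hκ1 : κ < 1) :
    ∀ G : ℝ, 0 < G →
      (Ωminus2 ωc ωm κ G = 0 ↔ G = Real.sqrt (ωm * ωc / (4 * (1 - κ))))
      ∧ (G < Real.sqrt (ωm * ωc / (4 * (1 - κ))) → 0 < Ωminus2 ωc ωm κ G) := by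
  intro G hG
  have hk : 0 < 4 * (1 - κ) := by linarith
  have hA : 0 < ((ωc + 4 * κ * G ^ 2 / ωm) * ωc + ωm ^ 2) / 2 := by positivity
  have hD : 0 ≤ ((ωc + 4 * κ * G ^ 2 / ωm) * ωc - ωm ^ 2) ^ 2 / 4
        + 4 * G ^ 2 * ωc * ωm := by positivity
  have key : (((ωc + 4 * κ * G ^ 2 / ωm) * ωc + ωm ^ 2) / 2) ^ 2
      - (((ωc + 4 * κ * G ^ 2 / ωm) * ωc - ωm ^ 2) ^ 2 / 4 + 4 * G ^ 2 * ωc * ωm)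
      = (ωc * ωm) * (ωm * ωc - G ^ 2 * (4 * (1 - κ))) := by
    field_simp
    ring
  have hcm : 0 < ωc * ωm := mul_pos hωc hωm
  have hq : 0 ≤ ωm * ωc / (4 * (1 - κ)) := by positivity
  unfold Ωminus2
  constructor
  · rw [sub_eq_zero, eq_comm, Real.sqrt_eq_iff_eq_sq hD hA.le, eq_comm (a := G),
      Real.sqrt_eq_iff_eq_sq hq hG.le, div_eq_iff hk.ne']
    constructor
    · intro h
      rw [h, sub_self] at key
      rcases mul_eq_zero.mp key.symm with h1 | h1
      · exact absurd h1 hcm.ne'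
      · linarith
    · intro h
      rw [h, sub_self, mul_zero] at key
      linarith
  · intro h
    rw [Real.lt_sqrt hG.le, lt_div_iff₀ hk] at h
    rw [sub_pos, Real.sqrt_lt' hA]
    have := mul_pos hcm (sub_pos.mpr h)
    linarith
end
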